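/- arXiv:1809.06819 — 5 statements merged into one kernel-verified Lean document; each statement's English description precedes it below -/
import Mathlib

section
/- For every cardinal κ with ω₁ ≤ κ ≤ 𝔟 there exists a separable metrizable CDH space of cardinality κ that is meager in itself. -/
open Set TopologicalSpace

/-- A space is countable dense homogeneous (CDH) if for any two countable dense subsets
`D`, `E` there is a homeomorphism of the space mapping `D` onto `E`. -/
def IsCDH (X : Type*) [TopologicalSpace X] : Prop :=
  ∀ D E : Set X, D.Countable → Dense D → E.Countable → Dense E →
    ∃ f : X ≃ₜ X, f '' D = E

/-- The bounding number `𝔟`: the least cardinality of a family `F ⊆ ω^ω` which is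
unbounded with respect to eventual domination `≤*`. -/
noncomputable def boundingNumber : Cardinal :=
  sInf {c : Cardinal | ∃ F : Set (ℕ → ℕ), Cardinal.mk F = c ∧
    ∀ g : ℕ → ℕ, ∃ f ∈ F, ¬ (∀ᶠ n in Filter.atTop, f n ≤ g n)}

open Filter Topology

namespace CountableDenseHomogeneous

/-- A refining sequence of finite clopen partitions of a space, given by labels, whose cells form
a neighbourhood basis at every point. -/
structure ClopenFiltration (X : Type*) [TopologicalSpace X] where
  /-- The label of the cell of the `n`-th partition containing a point. -/
  label : ℕ → X → ℕ
  continuous_label : ∀ n, Continuous (label n)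
  finite_range : ∀ n, (range (label n)).Finite
  label_of_succ : ∀ n x y, label (n + 1) x = label (n + 1) y → label n x = label n y
  exists_cell_subset : ∀ x, ∀ U ∈ 𝓝 x, ∃ n, ∀ y, label n y = label n x → y ∈ U

variable {X : Type*} [TopologicalSpace X]

theorem eventually_eq_of_continuous_nat {a : X → ℕ} (ha : Continuous a) (x : X) :
    ∀ᶠ y in 𝓝 x, a y = a x :=
  ha.continuousAt.eventually (show ∀ᶠ k in 𝓝 (a x), k = a x by simp)

namespace ClopenFiltration

theorem label_mono (c : ClopenFiltration X) {m n : ℕ} (h : m ≤ n) {x y : X}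
    (hxy : c.label n x = c.label n y) : c.label m x = c.label m y := by
  induction h with
  | refl => exact hxy
  | step _ ih => exact ih (c.label_of_succ _ _ _ hxy)

theorem eventually_label_eq (c : ClopenFiltration X) (n : ℕ) (x : X) :
    ∀ᶠ y in 𝓝 x, c.label n y = c.label n x :=
  eventually_eq_of_continuous_nat (c.continuous_label n) x

theorem exists_cell_subset_of_eventually (c : ClopenFiltration X) {x : X} {P : X → Prop}
    (h : ∀ᶠ y in 𝓝 x, P y) : ∃ n, ∀ y, c.label n y = c.label n x → P y :=
  c.exists_cell_subset x {y | P y} h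

/-- The filtration whose coarsest partition consists of the fibres of `a`. -/
def refineBy (c : ClopenFiltration X) (a : X → ℕ) (ha : Continuous a) (hfin : (range a).Finite) :
    ClopenFiltration X where
  label n x := Nat.casesOn n (a x) fun k => Nat.pair (a x) (c.label k x)
  continuous_label n := by
    cases n with
    | zero => exact ha
    | succ k =>
      exact (continuous_of_discreteTopology (f := fun z : ℕ × ℕ => Nat.pair z.1 z.2)).comp
        (ha.prodMk (c.continuous_label k))
  finite_range n := by
    cases n with
    | zero => exact hfin
    | succ k =>
      refine ((hfin.prod (c.finite_range k)).image fun z => Nat.pair z.1 z.2).subset ?_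
      rintro _ ⟨x, rfl⟩
      exact ⟨(a x, c.label k x), ⟨⟨x, rfl⟩, ⟨x, rfl⟩⟩, rfl⟩
  label_of_succ n x y h := by
    obtain ⟨h1, h2⟩ := Nat.pair_eq_pair.1 h
    cases n with
    | zero => exact h1
    | succ k => exact Nat.pair_eq_pair.2 ⟨h1, c.label_of_succ _ _ _ h2⟩
  exists_cell_subset x U hU := by
    obtain ⟨n, hn⟩ := c.exists_cell_subset x U hU
    exact ⟨n + 1, fun y hy => hn y (Nat.pair_eq_pair.1 hy).2⟩

@[simp] theorem refineBy_label_zero (c : ClopenFiltration X) (a : X → ℕ) (ha : Continuous a)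
    (hfin : (range a).Finite) : (c.refineBy a ha hfin).label 0 = a := rfl

/-- The complement of a closed set `K` splits into clopen pieces, the fibres of `ν`, each
associated with a point of `K`, such that the pieces converge to `K` along with these points. -/
theorem exists_pieces [Nonempty X] (c : ClopenFiltration X) {K : Set X} (hK : IsClosed K)
    (hK0 : ∀ x, ∃ p ∈ K, c.label 0 p = c.label 0 x) :
    ∃ (ν : X → ℕ) (p : ℕ → X), (∀ i, p i ∈ K) ∧
      (∀ x ∉ K, ∀ᶠ x' in 𝓝 x, ν x' = ν x) ∧
      (∀ x ∉ K, c.label 0 (p (ν x)) = c.label 0 x) ∧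
      (∀ x ∈ K, ∀ n, ∀ᶠ x' in 𝓝 x, x' ∉ K → n ≤ ν x') ∧
      (∀ x ∈ K, ∀ U ∈ 𝓝 x, ∀ᶠ x' in 𝓝 x, x' ∉ K → p (ν x') ∈ U) ∧
      (∀ x ∈ K, ∀ U ∈ 𝓝 x, ∃ j, ∀ᶠ q in 𝓝 x, ∀ x' ∉ K, j ≤ ν x' → p (ν x') = q → x' ∈ U) := by
  classical
  have hN : ∀ x, ∃ N, x ∉ K → (∀ p ∈ K, c.label N p ≠ c.label N x) ∧
      ∀ m < N, ∃ p ∈ K, c.label m p = c.label m x := by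
    intro x
    by_cases hx : x ∈ K
    · exact ⟨0, fun h => absurd hx h⟩
    · have h : ∃ n, ∀ p ∈ K, c.label n p ≠ c.label n x := by
        obtain ⟨n, hn⟩ := c.exists_cell_subset x Kᶜ (hK.isOpen_compl.mem_nhds hx)
        exact ⟨n, fun p hp hpx => hn p hpx hp⟩
      refine ⟨Nat.find h, fun _ => ⟨Nat.find_spec h, fun m hm => ?_⟩⟩
      have := Nat.find_min h hm
      push Not at this
      exact this
  choose N hN using hN
  have hN1 : ∀ x ∉ K, ∀ p ∈ K, c.label (N x) p ≠ c.label (N x) x := fun x hx => (hN x hx).1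
  have hN2 : ∀ x ∉ K, ∀ m < N x, ∃ p ∈ K, c.label m p = c.label m x := fun x hx => (hN x hx).2
  have hNpos : ∀ x ∉ K, 0 < N x := by
    intro x hx
    by_contra h
    obtain ⟨p, hp, hpx⟩ := hK0 x
    have h0 : N x = 0 := by omega
    exact hN1 x hx p hp (by rw [h0]; exact hpx)
  have hNlt : ∀ x ∈ K, ∀ n, ∀ x' ∉ K, c.label n x' = c.label n x → n < N x' := by
    intro x hx n x' hx' h
    by_contra hn
    exact hN1 x' hx' x hx (c.label_mono (not_lt.1 hn) h).symm
  let ν : X → ℕ := fun x => Nat.pair (N x) (c.label (N x) x)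
  have hp : ∀ i, ∃ p ∈ K, ∀ x ∉ K, ν x = i → c.label (N x - 1) p = c.label (N x - 1) x := by
    intro i
    by_cases h : ∃ x ∉ K, ν x = i
    · obtain ⟨x, hx, rfl⟩ := h
      obtain ⟨p, hpK, hpx⟩ := hN2 x hx (N x - 1) (by have := hNpos x hx; omega)
      refine ⟨p, hpK, fun x' _ hν => ?_⟩
      obtain ⟨h1, h2⟩ := Nat.pair_eq_pair.1 hν
      rw [h1] at h2 ⊢
      rw [hpx]
      exact (c.label_mono (Nat.sub_le _ _) h2).symm
    · obtain ⟨p, hpK, -⟩ := hK0 (Classical.arbitrary X)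
      exact ⟨p, hpK, fun x hx hi => absurd ⟨x, hx, hi⟩ h⟩
  choose p hpK hp using hp
  have hpl : ∀ n, ∀ x ∉ K, n < N x → c.label n (p (ν x)) = c.label n x := fun n x hx hn =>
    c.label_mono (by omega) (hp _ x hx rfl)
  refine ⟨ν, p, hpK, ?_, ?_, ?_, ?_, ?_⟩
  · intro x hx
    filter_upwards [c.eventually_label_eq (N x) x] with x' hx'
    have hx'K : x' ∉ K := fun h => hN1 x hx x' h hx'
    have hNN : N x' = N x := by
      apply le_antisymm
      · by_contra h
        obtain ⟨q, hq, hqx⟩ := hN2 x' hx'K (N x) (not_le.1 h)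
        exact hN1 x hx q hq (hqx.trans hx')
      · by_contra h
        obtain ⟨q, hq, hqx⟩ := hN2 x hx (N x') (not_le.1 h)
        exact hN1 x' hx'K q hq (hqx.trans (c.label_mono (not_le.1 h).le hx').symm)
    simp only [ν, hNN, hx']
  · exact fun x hx => hpl 0 x hx (hNpos x hx)
  · intro x hx n
    filter_upwards [c.eventually_label_eq n x] with x' hx' hx'K
    exact (hNlt x hx n x' hx'K hx').le.trans (Nat.left_le_pair _ _)
  · intro x hx U hU
    obtain ⟨n, hn⟩ := c.exists_cell_subset x U hU
    filter_upwards [c.eventually_label_eq n x] with x' hx' hx'K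
    exact hn _ ((hpl n x' hx'K (hNlt x hx n x' hx'K hx')).trans hx')
  · intro x hx U hU
    obtain ⟨n, hn⟩ := c.exists_cell_subset x U hU
    have hfin : (⋃ m ∈ Iic n, Nat.pair m '' range (c.label m)).Finite :=
      (finite_Iic n).biUnion fun m _ => (c.finite_range m).image _
    obtain ⟨j, hj⟩ := hfin.bddAbove
    refine ⟨j + 1, ?_⟩
    filter_upwards [c.eventually_label_eq n x] with q hq x' hx'K hjx hpq
    have hlt : n < N x' := by
      by_contra h
      have : ν x' ∈ ⋃ m ∈ Iic n, Nat.pair m '' range (c.label m) := by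
        simp only [mem_iUnion]
        exact ⟨N x', not_lt.1 h, _, ⟨x', rfl⟩, rfl⟩
      have := hj this
      omega
    refine hn _ ?_
    rw [← hpl n x' hx'K hlt, hpq, hq]

/-- A closed set meeting all cells of the coarsest partition is a retract, by a retraction
preserving these cells. -/
theorem exists_retraction [Nonempty X] (c : ClopenFiltration X) {K : Set X} (hK : IsClosed K)
    (hK0 : ∀ x, ∃ p ∈ K, c.label 0 p = c.label 0 x) :
    ∃ r : X → X, Continuous r ∧ (∀ x, r x ∈ K) ∧ (∀ x ∈ K, r x = x) ∧
      ∀ x, c.label 0 (r x) = c.label 0 x := by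
  classical
  obtain ⟨ν, p, hpK, hloc, h0, -, hlim, -⟩ := c.exists_pieces hK hK0
  refine ⟨fun x => if x ∈ K then x else p (ν x), ?_, ?_, fun x hx => if_pos hx, ?_⟩
  · refine continuous_iff_continuousAt.2 fun x => ?_
    by_cases hx : x ∈ K
    · intro U hU
      simp only [if_pos hx] at hU
      rw [mem_map]
      filter_upwards [hU, hlim x hx U hU] with x' h1 h2
      rw [mem_preimage]
      split_ifs with hx'
      exacts [h1, h2 hx']
    · refine (continuousAt_const (y := p (ν x))).congr ?_
      filter_upwards [hloc x hx, hK.isOpen_compl.mem_nhds hx] with x' h1 h2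
      rw [if_neg h2, h1]
  · intro x
    dsimp only
    split_ifs with hx
    exacts [hx, hpK _]
  · intro x
    dsimp only
    split_ifs with hx
    exacts [rfl, h0 x hx]

end ClopenFiltration

/-- A relation which is the graph of a continuous partial function with closed nowhere dense
domain. -/
structure IsThinMap (G : X → X → Prop) : Prop where
  isClosed_dom : IsClosed {x | ∃ y, G x y}
  interior_dom : interior {x | ∃ y, G x y} = ∅
  eventually_mem : ∀ x y, G x y → ∀ V ∈ 𝓝 y, ∀ᶠ x' in 𝓝 x, ∀ y', G x' y' → y' ∈ V

theorem IsThinMap.unique [T1Space X] {G : X → X → Prop} (hG : IsThinMap G) {x y y' : X}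
    (h : G x y) (h' : G x y') : y = y' := by
  by_contra hne
  exact (hG.eventually_mem x y h _ (isOpen_compl_singleton.mem_nhds hne)).self_of_nhds y' h' rfl

theorem interior_eq_empty_of_subset_union_compl {K K' D : Set X} (hK : IsClosed K)
    (hint : interior K = ∅) (hD : Dense D) (h : ∀ x ∈ K', x ∈ K ∨ x ∉ D) : interior K' = ∅ := by
  by_contra hne
  obtain ⟨x, hx⟩ := nonempty_iff_ne_empty.2 hne
  obtain ⟨y, hy, hyK⟩ := (interior_eq_empty_iff_dense_compl.1 hint).inter_open_nonempty _
    isOpen_interior ⟨x, hx⟩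
  obtain ⟨z, ⟨hz, hzK⟩, hzD⟩ := hD.inter_open_nonempty _
    (isOpen_interior.inter hK.isOpen_compl) ⟨y, hy, hyK⟩
  rcases h z (interior_subset hz) with h | h
  · exact hzK h
  · exact h hzD

/-- A thin partial homeomorphism extends to one defined on any given closed set missing a dense
set `D`, with the new values missing a dense set `E`, if `X` has closed copies of itself missing
`E` in all nonempty open sets. -/
theorem IsThinMap.exists_extension [Nonempty X] (c c' : ClopenFiltration X) {G : X → X → Prop}
    (hG : IsThinMap G) (hG' : IsThinMap (flip G))
    (hdom : ∀ x, ∃ p q, G p q ∧ c.label 0 p = c.label 0 x)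
    {D E F : Set X} (hD : Dense D) (hE : Dense E) (hF : IsClosed F) (hFD : ∀ x ∈ F, x ∉ D)
    (hcopy : ∀ U : Set X, IsOpen U → U.Nonempty →
      ∃ φ : X → X, IsClosedEmbedding φ ∧ ∀ x, φ x ∈ U ∧ φ x ∉ E) :
    ∃ G' : X → X → Prop, IsThinMap G' ∧ IsThinMap (flip G') ∧ (∀ x y, G x y → G' x y) ∧
      (∀ x ∈ F, ∃ y, G' x y) ∧
      ∀ x y, G' x y → G x y ∨ (x ∉ D ∧ y ∉ E ∧
        ∃ p q, G p q ∧ c.label 0 p = c.label 0 x ∧ c'.label 0 q = c'.label 0 y) := by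
  set K : Set X := {x | ∃ y, G x y} with hKdef
  set L : Set X := {y | ∃ x, flip G y x} with hLdef
  have hK : IsClosed K := hG.isClosed_dom
  have hL : IsClosed L := hG'.isClosed_dom
  obtain ⟨ν, p, hpK, hloc, hp0, hlarge, hlim, hback⟩ := c.exists_pieces hK fun x => by
    obtain ⟨p, q, hpq, h⟩ := hdom x
    exact ⟨p, ⟨q, hpq⟩, h⟩
  choose q hpq using hpK
  have hqL : ∀ i, q i ∈ L := fun i => ⟨p i, hpq i⟩
  have htarget : ∀ (m : ℕ) (i : ℕ), ∃ (V : Set X) (m' : ℕ), IsOpen V ∧ V.Nonempty ∧ m < m' ∧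
      (∀ v ∈ V, c'.label m v = c'.label m (q i)) ∧
      ∀ v ∈ V, ∀ l ∈ L, c'.label m' v ≠ c'.label m' l := by
    intro m i
    have hopen : ∀ m z, IsOpen {v | c'.label m v = c'.label m z} := fun m z =>
      (isOpen_discrete {c'.label m z}).preimage (c'.continuous_label m)
    obtain ⟨v, hv, hvL⟩ := (interior_eq_empty_iff_dense_compl.1
      hG'.interior_dom).inter_open_nonempty _ (hopen m (q i)) ⟨q i, rfl⟩
    obtain ⟨n, hn⟩ := c'.exists_cell_subset v Lᶜ (hL.isOpen_compl.mem_nhds hvL)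
    refine ⟨{w | c'.label (max n m + 1) w = c'.label (max n m + 1) v}, max n m + 1,
      hopen _ _, ⟨v, rfl⟩, by omega, fun w hw => ?_, fun w hw l hl hwl => ?_⟩
    · exact (c'.label_mono (by omega) hw).trans hv
    · exact hn l (c'.label_mono (by omega) (hwl.symm.trans hw)) hl
  choose V' m' hVo hVne hlt hVq hVL using htarget
  let m : ℕ → ℕ := fun i => Nat.rec 0 (fun i k => m' k i) i
  let V : ℕ → Set X := fun i => V' (m i) i
  have hmono : StrictMono m := strictMono_nat_of_lt_succ fun i => hlt (m i) i
  have hVq : ∀ i, ∀ v ∈ V i, c'.label (m i) v = c'.label (m i) (q i) := fun i => hVq (m i) i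
  have hVL : ∀ i, ∀ v ∈ V i, ∀ l ∈ L, c'.label (m (i + 1)) v ≠ c'.label (m (i + 1)) l :=
    fun i => hVL (m i) i
  have hVo : ∀ i, IsOpen (V i) := fun i => hVo (m i) i
  have hVne : ∀ i, (V i).Nonempty := fun i => hVne (m i) i
  clear_value m V
  choose φ hφ hφV using fun i => hcopy (V i) (hVo i) (hVne i)
  have hVnotL : ∀ i, ∀ v ∈ V i, v ∉ L := fun i v hv hvL => hVL i v hv v hvL rfl
  have hVnlt : ∀ i j v, v ∈ V i → v ∈ V j → ¬ i < j := fun i j v hi hj hij =>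
    hVL i v hi (q j) (hqL j) (c'.label_mono (hmono.monotone hij) (hVq j v hj))
  have hVinj : ∀ i j v, v ∈ V i → v ∈ V j → i = j := fun i j v hi hj =>
    le_antisymm (not_lt.1 (hVnlt j i v hj hi)) (not_lt.1 (hVnlt i j v hi hj))
  have hclopen : ∀ i, IsClosed {x | x ∈ F ∧ x ∉ K ∧ ν x = i} := by
    intro i
    refine hF.inter (s₂ := {x | x ∉ K ∧ ν x = i}) ?_
    rw [← isOpen_compl_iff, isOpen_iff_eventually]
    intro x hx
    by_cases hxK : x ∈ K
    · filter_upwards [hlarge x hxK (i + 1)] with x' hx' hx'i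
      have := hx' hx'i.1
      have := hx'i.2
      omega
    · filter_upwards [hloc x hxK] with x' hx' hx'i
      exact hx ⟨hxK, hx'.symm.trans hx'i.2⟩
  refine ⟨fun x y => G x y ∨ (x ∈ F ∧ x ∉ K ∧ y = φ (ν x) x), ⟨?_, ?_, ?_⟩, ⟨?_, ?_, ?_⟩,
    fun x y h => Or.inl h, ?_, ?_⟩
  · have : {x | ∃ y, G x y ∨ (x ∈ F ∧ x ∉ K ∧ y = φ (ν x) x)} = K ∪ F := by
      ext x
      constructor
      · rintro ⟨y, h | h⟩
        · exact Or.inl ⟨y, h⟩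
        · exact Or.inr h.1
      · rintro (⟨y, h⟩ | h)
        · exact ⟨y, Or.inl h⟩
        · by_cases hx : x ∈ K
          · exact hx.imp fun y h => Or.inl h
          · exact ⟨_, Or.inr ⟨h, hx, rfl⟩⟩
    rw [this]
    exact hK.union hF
  · refine interior_eq_empty_of_subset_union_compl hK hG.interior_dom hD ?_
    rintro x ⟨y, h | h⟩
    · exact Or.inl ⟨y, h⟩
    · exact Or.inr (hFD x h.1)
  · rintro x y (hxy | ⟨hxF, hxK, rfl⟩) W hW
    · have hxK : x ∈ K := ⟨y, hxy⟩
      obtain ⟨n, hn⟩ := c'.exists_cell_subset y W hW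
      have hU := hG.eventually_mem x y hxy _ (c'.eventually_label_eq n y)
      filter_upwards [hU, hlarge x hxK n, hlim x hxK _ hU] with x' h1 h2 h3
      rintro y' (h | ⟨-, hx'K, rfl⟩)
      · exact hn y' (h1 y' h)
      · refine hn _ ?_
        have hle : n ≤ m (ν x') := (h2 hx'K).trans (hmono.id_le _)
        exact (c'.label_mono hle (hVq _ _ (hφV (ν x') x').1)).trans (h3 hx'K _ (hpq _))
    · filter_upwards [hloc x hxK, hK.isOpen_compl.mem_nhds hxK,
        (hφ (ν x)).continuous.continuousAt.eventually hW] with x' h1 h2 h3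
      rintro y' (h | ⟨-, -, rfl⟩)
      · exact absurd ⟨y', h⟩ h2
      · rw [h1]
        exact h3
  · rw [← isOpen_compl_iff, isOpen_iff_eventually]
    intro y hy
    have hyL : y ∉ L := fun ⟨x, h⟩ => hy ⟨x, Or.inl h⟩
    obtain ⟨n, hn⟩ := c'.exists_cell_subset y Lᶜ (hL.isOpen_compl.mem_nhds hyL)
    have hfin : ∀ᶠ y' in 𝓝 y, ∀ i ∈ Iio n, y' ∉ φ i '' {x | x ∈ F ∧ x ∉ K ∧ ν x = i} := by
      refine (eventually_all_finite (finite_Iio n)).2 fun i _ => ?_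
      refine ((hφ i).isClosedMap _ (hclopen i)).isOpen_compl.mem_nhds ?_
      rintro ⟨x, ⟨hxF, hxK, rfl⟩, rfl⟩
      exact hy ⟨x, Or.inr ⟨hxF, hxK, rfl⟩⟩
    filter_upwards [hfin, c'.eventually_label_eq n y] with y' h1 h2
    rintro ⟨x, h | ⟨hxF, hxK, rfl⟩⟩
    · exact hn y' h2 ⟨x, h⟩
    · by_cases hi : ν x < n
      · exact h1 (ν x) hi ⟨x, ⟨hxF, hxK, rfl⟩, rfl⟩
      · refine hn (q (ν x)) ?_ (hqL _)
        have hle : n ≤ m (ν x) := (not_lt.1 hi).trans (hmono.id_le _)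
        exact (c'.label_mono hle (hVq _ _ (hφV (ν x) x).1)).symm.trans h2
  · refine interior_eq_empty_of_subset_union_compl hL hG'.interior_dom hE ?_
    rintro y ⟨x, h | ⟨-, -, rfl⟩⟩
    · exact Or.inl ⟨x, h⟩
    · exact Or.inr (hφV _ _).2
  · rintro y x (hxy | ⟨hxF, hxK, rfl⟩) U hU
    · have hxK : x ∈ K := ⟨y, hxy⟩
      obtain ⟨j, hj⟩ := hback x hxK U hU
      obtain ⟨n, hn⟩ :=
        c'.exists_cell_subset_of_eventually (hG'.eventually_mem y x hxy _ hj)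
      filter_upwards [hG'.eventually_mem y x hxy U hU,
        c'.eventually_label_eq (m (max j n)) y] with y' h1 h2
      rintro x' (h | ⟨-, hx'K, rfl⟩)
      · exact h1 x' h
      · have hv := (hφV (ν x') x').1
        have hi : max j n ≤ ν x' := by
          by_contra hlt
          exact hVL _ _ hv y ⟨x, hxy⟩ (c'.label_mono (hmono.monotone (not_le.1 hlt)) h2)
        have hle : n ≤ m (ν x') := (le_max_right j n).trans (hi.trans (hmono.id_le _))
        have hle' : n ≤ m (max j n) := (le_max_right j n).trans (hmono.id_le _)
        exact hn (q (ν x')) ((c'.label_mono hle (hVq _ _ hv)).symm.trans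
          (c'.label_mono hle' h2)) (p (ν x')) (hpq _) x' hx'K ((le_max_left j n).trans hi) rfl
    · have hv := (hφV (ν x) x).1
      obtain ⟨W, hW, hWU⟩ := mem_comap.1 ((hφ (ν x)).isInducing.nhds_eq_comap x ▸ hU)
      filter_upwards [(hVo _).mem_nhds hv, hW] with y' h1 h2
      rintro x' (h | ⟨-, -, rfl⟩)
      · exact absurd ⟨x', h⟩ (hVnotL _ _ h1)
      · have hi := hVinj _ _ _ h1 (hφV (ν x') x').1
        rw [← hi] at h2
        exact hWU h2
  · intro x hx
    by_cases hxK : x ∈ K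
    · exact hxK.imp fun y h => Or.inl h
    · exact ⟨_, Or.inr ⟨hx, hxK, rfl⟩⟩
  · rintro x y (h | ⟨hxF, hxK, rfl⟩)
    · exact Or.inl h
    · refine Or.inr ⟨hFD x hxF, (hφV _ _).2, p (ν x), q (ν x), hpq _, hp0 x hxK, ?_⟩
      exact (c'.label_mono (Nat.zero_le _) (hVq _ _ (hφV (ν x) x).1)).symm

theorem interior_singleton_eq_empty [Nonempty X]
    (hcopy : ∀ E : Set X, E.Countable → ∀ U : Set X, IsOpen U → U.Nonempty →
      ∃ φ : X → X, IsClosedEmbedding φ ∧ ∀ x, φ x ∈ U ∧ φ x ∉ E) (x : X) :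
    interior {x} = ∅ := by
  by_contra hne
  obtain ⟨φ, -, hφ⟩ := hcopy {x} (countable_singleton x) _ isOpen_interior
    (nonempty_iff_ne_empty.2 hne)
  exact (hφ x).2 (interior_subset (hφ x).1)

/-- Adding an isolated pair to a thin partial map whose domain misses it. -/
theorem IsThinMap.insert [T1Space X] {G : X → X → Prop} (hG : IsThinMap G)
    {d e : X} (hd : ∀ y, ¬ G d y) (hd0 : interior {d} = ∅) :
    IsThinMap fun x y => G x y ∨ (x = d ∧ y = e) := by
  have hdom : {x | ∃ y, G x y ∨ (x = d ∧ y = e)} = {x | ∃ y, G x y} ∪ {d} := by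
    ext x
    simp [exists_or, or_comm]
  refine ⟨?_, ?_, ?_⟩
  · rw [hdom]
    exact hG.isClosed_dom.union isClosed_singleton
  · rw [hdom, interior_union_isClosed_of_interior_empty hG.isClosed_dom hd0]
    exact hG.interior_dom
  · rintro x y (h | ⟨rfl, rfl⟩) V hV
    · have hne : x ≠ d := fun h' => hd y (h' ▸ h)
      filter_upwards [hG.eventually_mem x y h V hV, isOpen_compl_singleton.mem_nhds hne]
        with x' h1 h2
      rintro y' (h' | h')
      · exact h1 y' h'
      · exact absurd h'.1 h2
    · have hx : x ∈ {x | ∃ y, G x y}ᶜ := fun ⟨y, h⟩ => hd y h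
      filter_upwards [hG.isClosed_dom.isOpen_compl.mem_nhds hx] with x' h1
      rintro y' (h' | h')
      · exact absurd ⟨y', h'⟩ h1
      · exact h'.2 ▸ mem_of_mem_nhds hV

/-- A partial homeomorphism between closed nowhere dense sets, respecting the sets `D` and `E`,
along with matched finite clopen partitions of the space. -/
structure Approximation (D E : Set X) where
  /-- The graph of the partial homeomorphism. -/
  rel : X → X → Prop
  /-- The labels of the partition of the domain. -/
  a : X → ℕ
  /-- The labels of the partition of the codomain. -/
  b : X → ℕ
  left : IsThinMap rel
  right : IsThinMap (flip rel)
  continuous_a : Continuous a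
  continuous_b : Continuous b
  finite_a : (range a).Finite
  finite_b : (range b).Finite
  exists_rel_a : ∀ x, ∃ p q, rel p q ∧ a p = a x
  exists_rel_b : ∀ y, ∃ p q, rel p q ∧ b q = b y
  compat : ∀ x y, rel x y → a x = b y
  mem_iff : ∀ x y, rel x y → (x ∈ D ↔ y ∈ E)

namespace Approximation

variable {D E : Set X}

/-- The inverse approximation. -/
def swap (p : Approximation D E) : Approximation E D where
  rel := flip p.rel
  a := p.b
  b := p.a
  left := p.right
  right := p.left
  continuous_a := p.continuous_b
  continuous_b := p.continuous_a
  finite_a := p.finite_b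
  finite_b := p.finite_a
  exists_rel_a y := by
    obtain ⟨u, v, h, h'⟩ := p.exists_rel_b y
    exact ⟨v, u, h, h'⟩
  exists_rel_b x := by
    obtain ⟨u, v, h, h'⟩ := p.exists_rel_a x
    exact ⟨v, u, h, h'⟩
  compat y x h := (p.compat x y h).symm
  mem_iff y x h := (p.mem_iff x y h).symm

/-- `q` extends the partial homeomorphism of `p` and refines the partitions of `p`. -/
structure Extends (q p : Approximation D E) : Prop where
  rel : ∀ x y, p.rel x y → q.rel x y
  compat : ∀ x y, q.rel x y → p.a x = p.b y
  a : ∀ x x', q.a x = q.a x' → p.a x = p.a x'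
  b : ∀ y y', q.b y = q.b y' → p.b y = p.b y'

theorem Extends.refl (p : Approximation D E) : p.Extends p :=
  ⟨fun _ _ h => h, p.compat, fun _ _ h => h, fun _ _ h => h⟩

theorem Extends.trans {r q p : Approximation D E} (h : r.Extends q) (h' : q.Extends p) :
    r.Extends p where
  rel x y hxy := h.rel x y (h'.rel x y hxy)
  compat x y hxy := by
    obtain ⟨u, v, huv, hu⟩ := q.exists_rel_a x
    have hv : q.b v = q.b y := by rw [← q.compat u v huv, hu, h.compat x y hxy]
    rw [← h'.a u x hu, ← h'.b v y hv, h'.compat u v huv]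
  a x x' hx := h'.a x x' (h.a x x' hx)
  b y y' hy := h'.b y y' (h.b y y' hy)

theorem Extends.swap {q p : Approximation D E} (h : q.Extends p) : q.swap.Extends p.swap :=
  ⟨fun _ _ => h.rel _ _, fun _ _ hxy => (h.compat _ _ hxy).symm, h.b, h.a⟩

theorem exists_extends_closed [Nonempty X] (c : ClopenFiltration X) (hD : Dense D) (hE : Dense E)
    (hcopy : ∀ U : Set X, IsOpen U → U.Nonempty →
      ∃ φ : X → X, IsClosedEmbedding φ ∧ ∀ x, φ x ∈ U ∧ φ x ∉ E)
    (p : Approximation D E) {F : Set X} (hF : IsClosed F) (hFD : ∀ x ∈ F, x ∉ D) :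
    ∃ q : Approximation D E, q.Extends p ∧ ∀ x ∈ F, ∃ y, q.rel x y := by
  obtain ⟨G', h1, h2, h3, h4, h5⟩ := p.left.exists_extension
    (c.refineBy p.a p.continuous_a p.finite_a) (c.refineBy p.b p.continuous_b p.finite_b)
    p.right p.exists_rel_a hD hE hF hFD hcopy
  have hcompat : ∀ x y, G' x y → p.a x = p.b y := by
    intro x y h
    rcases h5 x y h with h | ⟨-, -, u, v, huv, hu, hv⟩
    · exact p.compat x y h
    · simp only [ClopenFiltration.refineBy_label_zero] at hu hv
      rw [← hu, ← hv, p.compat u v huv]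
  refine ⟨{ p with
    rel := G'
    left := h1
    right := h2
    exists_rel_a := fun x => ?_
    exists_rel_b := fun x => ?_
    compat := hcompat
    mem_iff := fun x y h => ?_ }, ⟨h3, hcompat, fun _ _ h => h, fun _ _ h => h⟩, h4⟩
  · obtain ⟨u, v, huv, h⟩ := p.exists_rel_a x
    exact ⟨u, v, h3 u v huv, h⟩
  · obtain ⟨u, v, huv, h⟩ := p.exists_rel_b x
    exact ⟨u, v, h3 u v huv, h⟩
  · rcases h5 x y h with h | ⟨hx, hy, -⟩
    · exact p.mem_iff x y h
    · exact iff_of_false hx hy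

theorem exists_extends_point [T1Space X] (hE : Dense E) (hX : ∀ x : X, interior {x} = ∅)
    (p : Approximation D E) {d : X} (hd : d ∈ D) :
    ∃ q : Approximation D E, q.Extends p ∧ q.a = p.a ∧ ∃ y, q.rel d y := by
  by_cases h : ∃ y, p.rel d y
  · exact ⟨p, .refl p, rfl, h⟩
  push Not at h
  obtain ⟨u, v, huv, hu⟩ := p.exists_rel_a d
  have hopen : IsOpen {y | p.b y = p.a d} :=
    (isOpen_discrete {p.a d}).preimage p.continuous_b
  obtain ⟨w, hw, hwL⟩ := (interior_eq_empty_iff_dense_compl.1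
    p.right.interior_dom).inter_open_nonempty _ hopen
      ⟨v, by rw [mem_ofPred, ← hu, p.compat u v huv]⟩
  obtain ⟨e, ⟨heb, heL⟩, he⟩ := hE.inter_open_nonempty _
    (hopen.inter p.right.isClosed_dom.isOpen_compl) ⟨w, hw, hwL⟩
  have hcompat : ∀ x y, (p.rel x y ∨ (x = d ∧ y = e)) → p.a x = p.b y := by
    rintro x y (hxy | ⟨rfl, rfl⟩)
    · exact p.compat x y hxy
    · exact heb.symm
  have hright := p.right.insert (d := e) (e := d) (fun x hx => heL ⟨x, hx⟩) (hX e)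
  have hflip : (fun y x => flip p.rel y x ∨ (y = e ∧ x = d)) =
      flip fun x y => p.rel x y ∨ (x = d ∧ y = e) := by
    funext y x
    simp [flip, and_comm]
  refine ⟨{ p with
    rel := fun x y => p.rel x y ∨ (x = d ∧ y = e)
    left := p.left.insert h (hX d)
    right := hflip ▸ hright
    exists_rel_a := fun x => ?_
    exists_rel_b := fun x => ?_
    compat := hcompat
    mem_iff := ?_ }, ⟨fun _ _ h => Or.inl h, hcompat, fun _ _ h => h, fun _ _ h => h⟩, rfl,
    e, Or.inr ⟨rfl, rfl⟩⟩
  · obtain ⟨u, v, huv, h⟩ := p.exists_rel_a x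
    exact ⟨u, v, Or.inl huv, h⟩
  · obtain ⟨u, v, huv, h⟩ := p.exists_rel_b x
    exact ⟨u, v, Or.inl huv, h⟩
  · rintro x y (hxy | ⟨rfl, rfl⟩)
    · exact p.mem_iff x y hxy
    · exact iff_of_true hd he

theorem exists_extends_finite [T1Space X] (hE : Dense E) (hX : ∀ x : X, interior {x} = ∅)
    (p : Approximation D E) {S : Set X} (hS : S.Finite) (hSD : S ⊆ D) :
    ∃ q : Approximation D E, q.Extends p ∧ q.a = p.a ∧ ∀ x ∈ S, ∃ y, q.rel x y := by
  induction S, hS using Set.Finite.induction_on with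
  | empty => exact ⟨p, .refl p, rfl, fun x hx => absurd hx (notMem_empty x)⟩
  | @insert d S _ _ ih =>
    obtain ⟨q, hqp, hqa, hq⟩ := ih fun x hx => hSD (mem_insert_of_mem d hx)
    obtain ⟨r, hrq, hra, hr⟩ := q.exists_extends_point hE hX (hSD (mem_insert d S))
    refine ⟨r, hrq.trans hqp, hra.trans hqa, ?_⟩
    rintro x (rfl | hx)
    · exact hr
    · exact (hq x hx).imp fun y h => hrq.rel x y h

theorem exists_extends_refine [T1Space X] (c : ClopenFiltration X) (hD : Dense D) (hE : Dense E)
    (hX : ∀ x : X, interior {x} = ∅) (p : Approximation D E) (k : ℕ) :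
    ∃ q : Approximation D E, q.Extends p ∧
      ∀ x x', q.a x = q.a x' → c.label k x = c.label k x' := by
  rcases isEmpty_or_nonempty X with hempty | hne
  · exact ⟨p, .refl p, fun x => hempty.elim x⟩
  let a : X → ℕ := fun x => Nat.pair (p.a x) (c.label k x)
  have ha : Continuous a :=
    (continuous_of_discreteTopology (f := fun z : ℕ × ℕ => Nat.pair z.1 z.2)).comp
      (p.continuous_a.prodMk (c.continuous_label k))
  have hfin : (range a).Finite := by
    refine ((p.finite_a.prod (c.finite_range k)).image fun z => Nat.pair z.1 z.2).subset ?_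
    rintro _ ⟨x, rfl⟩
    exact ⟨(p.a x, c.label k x), ⟨⟨x, rfl⟩, ⟨x, rfl⟩⟩, rfl⟩
  have hmeet : ∀ i ∈ range a, ∃ d ∈ D, a d = i := by
    rintro _ ⟨x, rfl⟩
    obtain ⟨d, hd, hdD⟩ := hD.inter_open_nonempty _
      ((isOpen_discrete {a x}).preimage ha) ⟨x, rfl⟩
    exact ⟨d, hdD, hd⟩
  choose! s hsD hs using hmeet
  obtain ⟨q, hqp, hqa, hq⟩ := p.exists_extends_finite hE hX (hfin.image s)
    (image_subset_iff.2 hsD)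
  obtain ⟨r, hr, hrL, hrid, hrb⟩ := (c.refineBy q.b q.continuous_b q.finite_b).exists_retraction
    q.right.isClosed_dom fun y => by
      obtain ⟨u, v, huv, h⟩ := q.exists_rel_b y
      exact ⟨v, ⟨u, huv⟩, h⟩
  simp only [ClopenFiltration.refineBy_label_zero] at hrb
  choose g hg using hrL
  have hg : ∀ y, q.rel (g y) (r y) := hg
  have haq : ∀ x x', a x = a x' → q.a x = q.a x' := by
    intro x x' h
    rw [hqa]
    exact (Nat.pair_eq_pair.1 h).1
  have hgu : ∀ x y, q.rel x y → g y = x ∧ r y = y := by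
    intro x y hxy
    have hy := hrid y ⟨x, hxy⟩
    have h := hg y
    rw [hy] at h
    exact ⟨q.right.unique h hxy, hy⟩
  refine ⟨{ q with
    a := a
    b := fun y => a (g y)
    continuous_a := ha
    continuous_b := ?_
    finite_a := hfin
    finite_b := hfin.subset (range_comp_subset_range g a)
    exists_rel_a := fun x => ?_
    exists_rel_b := fun y => ?_
    compat := fun x y h => ?_ }, Extends.trans (q := q) ⟨fun _ _ h => h, q.compat, haq, ?_⟩ hqp,
    fun x x' h => (Nat.pair_eq_pair.1 h).2⟩
  · refine IsLocallyConstant.continuous (IsLocallyConstant.iff_eventually_eq _ |>.2 fun y => ?_)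
    have h := q.right.eventually_mem (r y) (g y) (hg y) _
      (eventually_eq_of_continuous_nat ha (g y))
    filter_upwards [hr.continuousAt.eventually h] with y' hy'
    exact hy' (g y') (hg y')
  · obtain ⟨y, hy⟩ := hq (s (a x)) (mem_image_of_mem s ⟨x, rfl⟩)
    exact ⟨_, y, hy, hs (a x) ⟨x, rfl⟩⟩
  · exact ⟨g y, r y, hg y, by rw [(hgu _ _ (hg y)).1]⟩
  · rw [(hgu x y h).1]
  · intro y y' h
    have h' := haq _ _ h
    rwa [q.compat _ _ (hg y), q.compat _ _ (hg y'), hrb, hrb] at h'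

end Approximation

/-- A separable zero-dimensional space in which countable sets are `Gδ` and in which every
nonempty open set contains closed copies of the space missing any given countable set is CDH. -/
theorem isCDH_of_closed_copies [T1Space X] (c : ClopenFiltration X)
    (hGδ : ∀ D : Set X, D.Countable → IsGδ D)
    (hcopy : ∀ E : Set X, E.Countable → ∀ U : Set X, IsOpen U → U.Nonempty →
      ∃ φ : X → X, IsClosedEmbedding φ ∧ ∀ x, φ x ∈ U ∧ φ x ∉ E) : IsCDH X := by
  intro D E hDc hD hEc hE
  rcases isEmpty_or_nonempty X with hempty | hne
  · exact ⟨.refl X, Subsingleton.elim _ _⟩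
  have hX := interior_singleton_eq_empty hcopy
  obtain ⟨d, rfl⟩ := hDc.exists_eq_range hD.nonempty
  obtain ⟨e, rfl⟩ := hEc.exists_eq_range hE.nonempty
  have hcompl : ∀ D : Set X, D.Countable → ∃ F : ℕ → Set X, (∀ n, IsClosed (F n)) ∧
      (∀ n, ∀ x ∈ F n, x ∉ D) ∧ ∀ x ∉ D, ∃ n, x ∈ F n := by
    intro D hDc
    obtain ⟨W, hWo, rfl⟩ := (hGδ D hDc).eq_iInter_nat
    refine ⟨fun n => (W n)ᶜ, fun n => (hWo n).isClosed_compl,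
      fun n x hx h => hx (mem_iInter.1 h n), fun x hx => ?_⟩
    simpa using hx
  obtain ⟨F, hFc, hFD, hF⟩ := hcompl _ hDc
  obtain ⟨H, hHc, hHE, hH⟩ := hcompl _ hEc
  have hstep : ∀ (n : ℕ) (p : Approximation (range d) (range e)),
      ∃ q : Approximation (range d) (range e), q.Extends p ∧
        (∀ x, x ∈ F n ∨ x = d n → ∃ y, q.rel x y) ∧ (∀ y, y ∈ H n ∨ y = e n → ∃ x, q.rel x y) ∧
        (∀ x x', q.a x = q.a x' → c.label n x = c.label n x') ∧
        (∀ y y', q.b y = q.b y' → c.label n y = c.label n y') := by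
    intro n p
    obtain ⟨p₁, h₁, k₁⟩ := p.exists_extends_closed c hD hE (hcopy _ hEc) (hFc n) (hFD n)
    obtain ⟨p₂, h₂, -, k₂⟩ := p₁.exists_extends_point hE hX (mem_range_self n)
    obtain ⟨p₃, h₃, k₃⟩ := p₂.exists_extends_refine c hD hE hX n
    obtain ⟨p₄, h₄, k₄⟩ := p₃.swap.exists_extends_closed c hE hD (hcopy _ hDc) (hHc n) (hHE n)
    obtain ⟨p₅, h₅, -, k₅⟩ := p₄.exists_extends_point hD hX (mem_range_self n)
    obtain ⟨p₆, h₆, k₆⟩ := p₅.exists_extends_refine c hE hD hX n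
    have h₆₃ : p₆.swap.Extends p₃ := ((h₆.trans h₅).trans h₄).swap
    refine ⟨p₆.swap, h₆₃.trans (h₃.trans (h₂.trans h₁)), ?_, ?_,
      fun x x' h => k₃ x x' (h₆₃.a x x' h), k₆⟩
    · rintro x (hx | rfl)
      · exact (k₁ x hx).imp fun y h => h₆₃.rel _ _ (h₃.rel _ _ (h₂.rel _ _ h))
      · exact k₂.imp fun y h => h₆₃.rel _ _ (h₃.rel _ _ h)
    · rintro y (hy | rfl)
      · exact (k₄ y hy).imp fun x h => h₆.rel _ _ (h₅.rel _ _ h)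
      · exact k₅.imp fun x h => h₆.rel _ _ h
  have hsingle : ∀ x y : X, IsThinMap fun x' y' => x' = x ∧ y' = y := by
    intro x y
    have hdom : {x' | ∃ y', x' = x ∧ y' = y} = {x} := by
      ext x'
      simp
    refine ⟨hdom ▸ isClosed_singleton, hdom ▸ hX x, ?_⟩
    rintro _ _ ⟨rfl, rfl⟩ V hV
    exact Eventually.of_forall fun x' y' h => h.2 ▸ mem_of_mem_nhds hV
  let p₀ : Approximation (range d) (range e) :=
    { rel := fun x y => x = d 0 ∧ y = e 0
      a := fun _ => 0
      b := fun _ => 0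
      left := hsingle _ _
      right := by
        have : (flip fun x y => x = d 0 ∧ y = e 0) = fun y x => y = e 0 ∧ x = d 0 := by
          funext y x
          simp [flip, and_comm]
        exact this ▸ hsingle (e 0) (d 0)
      continuous_a := continuous_const
      continuous_b := continuous_const
      finite_a := (finite_singleton 0).subset (range_subset_iff.2 fun _ => rfl)
      finite_b := (finite_singleton 0).subset (range_subset_iff.2 fun _ => rfl)
      exists_rel_a := fun _ => ⟨_, _, ⟨rfl, rfl⟩, rfl⟩
      exists_rel_b := fun _ => ⟨_, _, ⟨rfl, rfl⟩, rfl⟩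
      compat := fun _ _ _ => rfl
      mem_iff := by
        rintro _ _ ⟨rfl, rfl⟩
        exact iff_of_true (mem_range_self 0) (mem_range_self 0) }
  choose next hnext hdom hcod hla hlb using hstep
  let P : ℕ → Approximation (range d) (range e) := fun n => Nat.rec p₀ (fun n p => next n p) n
  have hPsucc : ∀ n, P (n + 1) = next n (P n) := fun _ => rfl
  have hP : ∀ m n, m ≤ n → (P n).Extends (P m) := by
    intro m n h
    induction h with
    | refl => exact .refl _
    | step _ ih => exact (hnext _ _).trans ih
  have htotal : ∀ x, ∃ y n, (P n).rel x y := by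
    intro x
    by_cases hx : x ∈ range d
    · obtain ⟨n, rfl⟩ := hx
      obtain ⟨y, hy⟩ := hdom n (P n) (d n) (Or.inr rfl)
      exact ⟨y, n + 1, hy⟩
    · obtain ⟨n, hn⟩ := hF x hx
      obtain ⟨y, hy⟩ := hdom n (P n) x (Or.inl hn)
      exact ⟨y, n + 1, hy⟩
  have hsurj : ∀ y, ∃ x n, (P n).rel x y := by
    intro y
    by_cases hy : y ∈ range e
    · obtain ⟨n, rfl⟩ := hy
      obtain ⟨x, hx⟩ := hcod n (P n) (e n) (Or.inr rfl)
      exact ⟨x, n + 1, hx⟩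
    · obtain ⟨n, hn⟩ := hH y hy
      obtain ⟨x, hx⟩ := hcod n (P n) y (Or.inl hn)
      exact ⟨x, n + 1, hx⟩
  clear_value P
  choose f nf hf using htotal
  choose g ng hg using hsurj
  have hgf : ∀ x, g (f x) = x := fun x =>
    (P (max (nf x) (ng (f x)))).right.unique
      ((hP _ _ (le_max_right _ _)).rel _ _ (hg (f x)))
      ((hP _ _ (le_max_left _ _)).rel _ _ (hf x))
  have hfg : ∀ y, f (g y) = y := fun y =>
    (P (max (nf (g y)) (ng y))).left.unique
      ((hP _ _ (le_max_left _ _)).rel _ _ (hf (g y)))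
      ((hP _ _ (le_max_right _ _)).rel _ _ (hg y))
  have hcompat : ∀ n x, (P n).a x = (P n).b (f x) := fun n x =>
    (hP _ _ (le_max_left n (nf x))).compat _ _ ((hP _ _ (le_max_right n (nf x))).rel _ _ (hf x))
  have hfc : Continuous f := by
    refine continuous_iff_continuousAt.2 fun x U hU => ?_
    obtain ⟨n, hn⟩ := c.exists_cell_subset _ U hU
    rw [mem_map]
    filter_upwards [eventually_eq_of_continuous_nat (P (n + 1)).continuous_a x] with x' hx'
    exact hn _ (hlb n (P n) _ _ (by rw [← hPsucc, ← hcompat, ← hcompat, hx']))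
  have hgc : Continuous g := by
    refine continuous_iff_continuousAt.2 fun y U hU => ?_
    obtain ⟨n, hn⟩ := c.exists_cell_subset _ U hU
    rw [mem_map]
    filter_upwards [eventually_eq_of_continuous_nat (P (n + 1)).continuous_b y] with y' hy'
    exact hn _ (hla n (P n) _ _ (by rw [← hPsucc, hcompat, hcompat, hfg, hfg, hy']))
  refine ⟨⟨⟨f, g, hgf, hfg⟩, hfc, hgc⟩, ?_⟩
  have hmem : ∀ x, x ∈ range d ↔ f x ∈ range e := fun x => (P (nf x)).mem_iff _ _ (hf x)
  ext y
  constructor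
  · rintro ⟨x, hx, rfl⟩
    exact (hmem x).1 hx
  · intro hy
    exact ⟨g y, (hmem _).2 (by rwa [hfg]), hfg y⟩

theorem isMeagre_univ_of_closed_copies [SeparableSpace X] [T1Space X]
    (hGδ : ∀ D : Set X, D.Countable → IsGδ D)
    (hcopy : ∀ E : Set X, E.Countable → ∀ U : Set X, IsOpen U → U.Nonempty →
      ∃ φ : X → X, IsClosedEmbedding φ ∧ ∀ x, φ x ∈ U ∧ φ x ∉ E) :
    IsMeagre (univ : Set X) := by
  obtain ⟨D, hDc, hD⟩ := exists_countable_dense X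
  obtain ⟨W, hWo, hDW⟩ := (hGδ D hDc).eq_iInter_nat
  have hD' : IsMeagre D := by
    rw [← biUnion_of_singleton D]
    refine isMeagre_biUnion hDc fun x _ => IsNowhereDense.isMeagre ?_
    have : Nonempty X := ⟨x⟩
    rw [isClosed_singleton.isNowhereDense_iff]
    exact interior_singleton_eq_empty hcopy x
  have hDc' : IsMeagre Dᶜ := by
    rw [hDW, compl_iInter]
    refine isMeagre_iUnion fun n => IsNowhereDense.isMeagre ?_
    rw [(hWo n).isClosed_compl.isNowhereDense_iff, interior_compl,
      (hD.mono (hDW.trans_subset (iInter_subset W n))).closure_eq, compl_univ]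
  rw [← union_compl_self D]
  exact hD'.union hDc'

open Function

theorem _root_.Topology.IsInducing.exists_forall_lt_eq_imp_mem {e : X → ℕ → ℕ} (he : IsInducing e)
    {x : X} {U : Set X} (hU : U ∈ 𝓝 x) : ∃ n, ∀ y, (∀ k < n, e y k = e x k) → y ∈ U := by
  obtain ⟨V, hV, hVU⟩ := (he.nhds_eq_comap x ▸ hU : U ∈ comap e (𝓝 (e x)))
  rw [nhds_pi, Filter.mem_pi'] at hV
  obtain ⟨s, t, ht, hst⟩ := hV
  refine ⟨s.sup id + 1, fun y hy => hVU (hst fun k hk => ?_)⟩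
  rw [hy k (Nat.lt_succ_of_le (Finset.le_sup (f := id) hk))]
  exact mem_of_mem_nhds (ht k)

/-- The binary expansion, lowest level last, of the truth values of the equations
`e x i = j` for `Nat.pair i j < n`. -/
def binaryLabel {Y : Type*} (e : Y → ℕ → ℕ) : ℕ → Y → ℕ
  | 0, _ => 0
  | n + 1, x => 2 * binaryLabel e n x + if e x n.unpair.1 = n.unpair.2 then 1 else 0

theorem binaryLabel_of_succ {Y : Type*} {e : Y → ℕ → ℕ} {n : ℕ} {x y : Y}
    (h : binaryLabel e (n + 1) x = binaryLabel e (n + 1) y) :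
    binaryLabel e n x = binaryLabel e n y ∧
      (e x n.unpair.1 = n.unpair.2 ↔ e y n.unpair.1 = n.unpair.2) := by
  simp only [binaryLabel] at h
  split_ifs at h <;> constructor <;> omega

theorem eq_of_binaryLabel_eq {Y : Type*} {e : Y → ℕ → ℕ} {n : ℕ} {x y : Y}
    (h : binaryLabel e n y = binaryLabel e n x) {i : ℕ} (hi : Nat.pair i (e x i) < n) :
    e y i = e x i := by
  induction n with
  | zero => omega
  | succ n ih =>
    obtain ⟨h1, h2⟩ := binaryLabel_of_succ h
    rcases Nat.lt_succ_iff_lt_or_eq.1 hi with hi | rfl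
    · exact ih h1 hi
    · simpa using h2

/-- A space which embeds into `ℕ → ℕ` carries a clopen filtration. -/
def ClopenFiltration.ofInducing {e : X → ℕ → ℕ} (he : IsInducing e) : ClopenFiltration X where
  label := binaryLabel e
  continuous_label n := by
    induction n with
    | zero => exact continuous_const
    | succ n ih =>
      have h1 : Continuous fun x => e x n.unpair.1 := (continuous_apply _).comp he.continuous
      have h2 : Continuous fun z : ℕ × ℕ => 2 * z.1 + if z.2 = n.unpair.2 then 1 else 0 :=
        continuous_of_discreteTopology
      exact h2.comp (ih.prodMk h1)
  finite_range n := by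
    have h : ∀ x, binaryLabel e n x < 2 ^ n := fun x => by
      induction n with
      | zero => simp [binaryLabel]
      | succ n ih =>
        simp only [binaryLabel, pow_succ]
        split_ifs <;> omega
    refine (Set.finite_lt_nat (2 ^ n)).subset ?_
    rintro _ ⟨x, rfl⟩
    exact h x
  label_of_succ _ _ _ h := (binaryLabel_of_succ h).1
  exists_cell_subset x U hU := by
    obtain ⟨n, hn⟩ := he.exists_forall_lt_eq_imp_mem hU
    refine ⟨(Finset.range n).sup (fun i => Nat.pair i (e x i)) + 1, fun y hy => hn y fun i hi => ?_⟩
    exact eq_of_binaryLabel_eq hy (Nat.lt_succ_of_le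
      (Finset.le_sup (f := fun i => Nat.pair i (e x i)) (Finset.mem_range.2 hi)))

theorem exists_eventually_lt_of_mk_lt {S : Set (ℕ → ℕ)} (hS : Cardinal.mk S < boundingNumber) :
    ∃ g : ℕ → ℕ, ∀ f ∈ S, ∀ᶠ n in atTop, f n < g n := by
  by_contra h
  refine hS.not_ge (csInf_le' ⟨S, rfl, fun g => ?_⟩)
  by_contra hg
  push Not at hg
  exact h ⟨fun n => g n + 1, fun f hf => (hg f hf).mono fun n hn => Nat.lt_succ_of_le hn⟩

theorem exists_unbounded_mk_eq_boundingNumber : ∃ F : Set (ℕ → ℕ),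
    Cardinal.mk F = boundingNumber ∧ ∀ g : ℕ → ℕ, ∃ f ∈ F, ¬ ∀ᶠ n in atTop, f n ≤ g n := by
  refine csInf_mem (s := {c : Cardinal | ∃ F : Set (ℕ → ℕ), Cardinal.mk F = c ∧
    ∀ g : ℕ → ℕ, ∃ f ∈ F, ¬ ∀ᶠ n in atTop, f n ≤ g n})
      ⟨_, univ, rfl, fun g => ⟨fun n => g n + 1, mem_univ _, fun h => ?_⟩⟩
  obtain ⟨n, hn⟩ := h.exists
  exact absurd hn (Nat.not_succ_le_self _)

/-- A countable set can be separated by a `Gδ` set from any disjoint set of size less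
than `boundingNumber`. -/
theorem exists_isGδ_superset_disjoint {A Z : Set (ℕ → ℕ)} (hA : A.Countable)
    (hZ : Cardinal.mk Z < boundingNumber) (hAZ : Disjoint A Z) :
    ∃ H : Set (ℕ → ℕ), IsGδ H ∧ A ⊆ H ∧ Disjoint H Z := by
  rcases A.eq_empty_or_nonempty with rfl | hne
  · exact ⟨∅, IsGδ.empty, Subset.rfl, empty_disjoint _⟩
  obtain ⟨a, rfl⟩ := hA.exists_eq_range hne
  have hdiff : ∀ z : Z, ∀ n, ∃ j, z.1 j ≠ a n j := fun z n =>
    Function.ne_iff.1 fun h => disjoint_left.1 hAZ ⟨n, h.symm⟩ z.2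
  choose d hd using hdiff
  obtain ⟨g, hg⟩ := exists_eventually_lt_of_mk_lt
    (S := range d) (Cardinal.mk_range_le.trans_lt hZ)
  refine ⟨⋂ m, ⋃ n, PiNat.cylinder (a n) (max (g n) m), ?_, ?_, ?_⟩
  · exact IsGδ.iInter_of_isOpen fun m => isOpen_iUnion fun n => PiNat.isOpen_cylinder _ _ _
  · rintro _ ⟨n, rfl⟩
    exact mem_iInter.2 fun m => mem_iUnion.2 ⟨n, PiNat.self_mem_cylinder _ _⟩
  · refine disjoint_left.2 fun z hz hzZ => ?_
    obtain ⟨M, hM⟩ := eventually_atTop.1 (hg _ ⟨⟨z, hzZ⟩, rfl⟩)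
    obtain ⟨n, hn⟩ := mem_iUnion.1
      (mem_iInter.1 hz ((Finset.range M).sup (fun n => d ⟨z, hzZ⟩ n) + 1))
    refine hd ⟨z, hzZ⟩ n (PiNat.mem_cylinder_iff.1 hn _ (lt_max_iff.2 ?_))
    rcases le_or_gt M n with h | h
    · exact Or.inl (hM n h)
    · exact Or.inr (Nat.lt_succ_of_le
        (Finset.le_sup (f := fun n => d ⟨z, hzZ⟩ n) (Finset.mem_range.2 h)))

/-- Fewer than `boundingNumber` many points can be cut down to a countable subset
by a `Gδ` set. -/
theorem exists_isGδ_preimage_eq {I : Type} {f : I → ℕ → ℕ} (hf : Injective f) {A : Set I}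
    (hA : A.Countable) {G : Set (ℕ → ℕ)} (hG : IsGδ G) (hAG : ∀ i ∈ A, f i ∈ G)
    (hcard : Cardinal.mk (f ⁻¹' G) < boundingNumber) :
    ∃ H : Set (ℕ → ℕ), IsGδ H ∧ f ⁻¹' H = A := by
  obtain ⟨H, hH, hAH, hHZ⟩ := exists_isGδ_superset_disjoint (A := f '' A)
    (Z := f '' (f ⁻¹' G \ A)) (hA.image f)
    (((Cardinal.mk_image_le).trans (Cardinal.mk_le_mk_of_subset sdiff_subset)).trans_lt hcard)
    ((disjoint_image_iff hf).2 disjoint_sdiff_right)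
  refine ⟨H ∩ G, hH.inter hG, Subset.antisymm (fun i hi => ?_) fun i hi => ?_⟩
  · by_contra hiA
    exact disjoint_left.1 hHZ hi.1 ⟨i, ⟨hi.2, hiA⟩, rfl⟩
  · exact ⟨hAH ⟨i, hi, rfl⟩, hAG i hi⟩

/-- Any family of at most `boundingNumber` many functions, indexed in its order type, is
dominated by a strictly increasing scale. -/
theorem exists_scale {I : Type} [LinearOrder I] [WellFoundedLT I]
    (hI : ∀ i : I, Cardinal.mk (Iio i) < boundingNumber)
    (h0 : Cardinal.aleph0 < boundingNumber) (F : I → ℕ → ℕ) :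
    ∃ f : I → ℕ → ℕ, (∀ i, ∀ᶠ n in atTop, F i n < f i n) ∧
      ∀ i, ∀ j < i, ∀ᶠ n in atTop, f j n < f i n := by
  have key : ∀ (i : I) (p : ∀ j, j < i → ℕ → ℕ), ∃ g : ℕ → ℕ,
      (∀ᶠ n in atTop, F i n < g n) ∧ ∀ j (hj : j < i), ∀ᶠ n in atTop, p j hj n < g n := by
    intro i p
    obtain ⟨g, hg⟩ := exists_eventually_lt_of_mk_lt
      (S := insert (F i) (range fun j : Iio i => p j.1 j.2))
      (Cardinal.mk_insert_le.trans_lt (Cardinal.add_lt_of_lt h0.le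
        (Cardinal.mk_range_le.trans_lt (hI i)) (Cardinal.one_lt_aleph0.trans h0)))
    exact ⟨g, hg _ (mem_insert _ _), fun j hj => hg _ (mem_insert_of_mem _ ⟨⟨j, hj⟩, rfl⟩)⟩
  choose step hstep using key
  let f : I → ℕ → ℕ := wellFounded_lt.fix step
  have hfix : ∀ i, f i = step i fun j _ => f j := fun i => wellFounded_lt.fix_eq step i
  refine ⟨f, fun i => ?_, fun i j hj => ?_⟩
  · rw [hfix i]
    exact (hstep i _).1
  · rw [hfix i]
    exact (hstep i fun j _ => f j).2 j hj

/-- For every uncountable size up to `boundingNumber` there is a `λ`-set in `ℕ → ℕ`, that is,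
a set all of whose countable subsets are relatively `Gδ`. -/
theorem exists_lambda_set {κ : Cardinal} (h0 : Cardinal.aleph0 < κ) (hκ : κ ≤ boundingNumber) :
    ∃ (I : Type) (f : I → ℕ → ℕ), Injective f ∧ Cardinal.mk I = κ ∧
      ∀ A : Set I, A.Countable → ∃ H : Set (ℕ → ℕ), IsGδ H ∧ f ⁻¹' H = A := by
  obtain ⟨B, hB, hBu⟩ := exists_unbounded_mk_eq_boundingNumber
  let I := κ.ord.ToType
  have hI : Cardinal.mk I = κ := Cardinal.mk_ord_toType κ
  have hIio : ∀ i : I, Cardinal.mk (Iio i) < κ := fun i =>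
    (Cardinal.mk_Iio_lt i (by simp [I])).trans_eq hI
  obtain ⟨F, hF⟩ : ∃ F : I → ℕ → ℕ, κ = boundingNumber → range F = B := by
    by_cases h : κ = boundingNumber
    · obtain ⟨e⟩ := Cardinal.eq.1 (hI.trans (h.trans hB.symm))
      exact ⟨fun i => e i, fun _ => by rw [range_comp' Subtype.val e]; simp⟩
    · exact ⟨0, fun h' => absurd h' h⟩
  obtain ⟨f, hFf, hf⟩ := exists_scale (fun i => (hIio i).trans_le hκ) (h0.trans_le hκ) F
  have hne : ∀ i j, j < i → f j ≠ f i := fun i j hj h => by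
    obtain ⟨n, hn⟩ := (hf i j hj).exists
    exact hn.ne (congrFun h n)
  have hinj : Injective f := fun i j h => by
    by_contra hij
    rcases lt_or_gt_of_ne hij with hij | hij
    · exact hne j i hij h
    · exact hne i j hij h.symm
  refine ⟨I, f, hinj, hI, fun A hA => ?_⟩
  rcases hκ.lt_or_eq with hlt | heq
  · exact exists_isGδ_preimage_eq hinj hA IsGδ.univ (fun _ _ => mem_univ _)
      ((Cardinal.mk_set_le _).trans_lt (hI.trans_lt hlt))
  obtain ⟨g, hg⟩ := exists_eventually_lt_of_mk_lt (S := f '' A)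
    ((Cardinal.le_aleph0_iff_set_countable.2 (hA.image f)).trans_lt (h0.trans_le hκ))
  obtain ⟨b, hb, hbg⟩ := hBu g
  obtain ⟨i, rfl⟩ := (hF heq).symm ▸ hb
  have hfreq : ∃ᶠ n in atTop, g n < f i n := by
    refine ((not_eventually.1 hbg).and_eventually (hFf i)).mono fun n hn => ?_
    exact (not_le.1 hn.1).trans hn.2
  refine exists_isGδ_preimage_eq hinj hA (G := {x | ∃ᶠ n in atTop, x n ≤ f i n}) ?_ ?_ ?_
  · have : {x : ℕ → ℕ | ∃ᶠ n in atTop, x n ≤ f i n} = ⋂ m, ⋃ n ≥ m, {x | x n ≤ f i n} := by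
      ext x
      simp [frequently_atTop]
    rw [this]
    exact IsGδ.iInter_of_isOpen fun m => isOpen_biUnion fun n _ =>
      (isOpen_discrete (Iic (f i n))).preimage (continuous_apply (A := fun _ : ℕ => ℕ) n)
  · intro j hj
    exact (hfreq.and_eventually (hg _ ⟨j, hj, rfl⟩)).mono fun n hn => (hn.2.trans hn.1).le
  · refine ((Cardinal.mk_le_mk_of_subset fun j hj => ?_).trans
      (Cardinal.mk_insert_le (a := i) (s := Iio i))).trans_lt
      (Cardinal.add_lt_of_lt (h0.le.trans hκ) ((hIio i).trans_le hκ)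
        (Cardinal.one_lt_aleph0.trans (h0.trans_le hκ)))
    by_contra hji
    have hij : i < j := by
      simp only [mem_insert_iff, mem_Iio, not_or, not_lt] at hji
      exact lt_of_le_of_ne hji.2 (Ne.symm hji.1)
    obtain ⟨n, hn1, hn2⟩ := (Frequently.and_eventually hj (hf j i hij)).exists
    omega

/-- The points of the countable power of `I` which are eventually equal to `o`. -/
abbrev WeakPower (I : Type) (o : I) : Type :=
  {x : ℕ → I // ∀ᶠ n in atTop, x n = o}

namespace WeakPower

variable {I : Type} {o : I}

/-- The sequence listing all digits of all coordinates under the given codes `f`. -/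
def code (f : I → ℕ → ℕ) (x : WeakPower I o) (k : ℕ) : ℕ :=
  f (x.1 k.unpair.1) k.unpair.2

theorem code_injective {f : I → ℕ → ℕ} (hf : Injective f) :
    Injective (code f : WeakPower I o → ℕ → ℕ) := fun x y h =>
  Subtype.ext (funext fun n => hf (funext fun j => by
    simpa [code] using congrFun h (Nat.pair n j)))

/-- The point with the entries of a list, followed by the constant value `o`. -/
def ofList (o : I) (l : List I) : WeakPower I o :=
  ⟨fun n => l.getD n o, eventually_atTop.2 ⟨l.length, fun n hn => by simp [hn]⟩⟩

theorem exists_ofList_eq (x : WeakPower I o) {B : Set I} (hB : ∀ n, x.1 n ∈ B) :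
    ∃ l : List B, ofList o (l.map Subtype.val) = x := by
  obtain ⟨N, hN⟩ := eventually_atTop.1 x.2
  refine ⟨(List.range N).map fun n => ⟨x.1 n, hB n⟩, Subtype.ext (funext fun n => ?_)⟩
  rcases lt_or_ge n N with h | h
  · simp [ofList, h]
  · simp [ofList, h, hN n h]

theorem mk_eq (h : Cardinal.aleph0 ≤ Cardinal.mk I) :
    Cardinal.mk (WeakPower I o) = Cardinal.mk I := by
  have : Infinite I := Cardinal.infinite_iff.2 h
  refine le_antisymm ?_ ?_
  · rw [← Cardinal.mk_list_eq_mk I]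
    refine Cardinal.mk_le_of_surjective (f := ofList o) fun x => ?_
    obtain ⟨l, hl⟩ := x.exists_ofList_eq (B := univ) fun _ => mem_univ _
    exact ⟨_, hl⟩
  · refine Cardinal.mk_le_of_injective (f := fun i => ofList o [i]) fun i j hij => ?_
    simpa [ofList] using congrFun (congrArg Subtype.val hij) 0

theorem countable_setOf_forall_mem {B : Set I} (hB : B.Countable) :
    {x : WeakPower I o | ∀ n, x.1 n ∈ B}.Countable := by
  have : Countable B := hB.to_subtype
  refine (countable_range fun l : List B => ofList o (l.map Subtype.val)).mono fun x hx => ?_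
  exact x.exists_ofList_eq hx

/-- The point with the first `N` entries of `x₀`, followed by `i` and the entries of `x`. -/
def splice (x₀ : WeakPower I o) (N : ℕ) (i : I) (x : WeakPower I o) : WeakPower I o :=
  ⟨fun n => if n < N then x₀.1 n else if n = N then i else x.1 (n - (N + 1)), by
    obtain ⟨M, hM⟩ := eventually_atTop.1 x.2
    refine eventually_atTop.2 ⟨M + (N + 1), fun n hn => ?_⟩
    beta_reduce
    rw [if_neg (by omega), if_neg (by omega)]
    exact hM _ (by omega)⟩

/-- The point obtained by deleting the first `N` entries. -/
def shift (N : ℕ) (x : WeakPower I o) : WeakPower I o :=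
  ⟨fun n => x.1 (n + N), (tendsto_add_atTop_nat N).eventually x.2⟩

theorem shift_splice (x₀ : WeakPower I o) (N : ℕ) (i : I) :
    LeftInverse (shift (N + 1)) (splice x₀ N i) := fun x =>
  Subtype.ext (funext fun n => by
    simp only [shift, splice]
    rw [if_neg (by omega), if_neg (by omega), Nat.add_sub_cancel])

section Topology

variable [TopologicalSpace (WeakPower I o)] {f : I → ℕ → ℕ}

theorem continuous_coord (hf : IsInducing (code f : WeakPower I o → ℕ → ℕ)) (n j : ℕ) :
    Continuous fun x : WeakPower I o => f (x.1 n) j := by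
  have := (continuous_apply (A := fun _ : ℕ => ℕ) (Nat.pair n j)).comp hf.continuous
  simpa [comp_def, code] using this

theorem continuous_of_coord (hf : IsInducing (code f : WeakPower I o → ℕ → ℕ))
    {φ : WeakPower I o → WeakPower I o}
    (h : ∀ n j, Continuous fun x => f ((φ x).1 n) j) : Continuous φ :=
  hf.continuous_iff.2 (continuous_pi fun k => h k.unpair.1 k.unpair.2)

theorem isClosedEmbedding_splice [T2Space (WeakPower I o)]
    (hf : IsInducing (code f : WeakPower I o → ℕ → ℕ)) (x₀ : WeakPower I o) (N : ℕ) (i : I) :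
    IsClosedEmbedding (splice x₀ N i) := by
  refine (shift_splice x₀ N i).isClosedEmbedding
    (continuous_of_coord hf fun n j => continuous_coord hf (n + (N + 1)) j)
    (continuous_of_coord hf fun n j => ?_)
  simp only [splice]
  split_ifs
  · exact continuous_const
  · exact continuous_const
  · exact continuous_coord hf _ j

theorem isGδ_of_countable [T1Space (WeakPower I o)]
    (hf : IsInducing (code f : WeakPower I o → ℕ → ℕ))
    (hlam : ∀ A : Set I, A.Countable → ∃ H : Set (ℕ → ℕ), IsGδ H ∧ f ⁻¹' H = A)
    {D : Set (WeakPower I o)} (hD : D.Countable) : IsGδ D := by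
  have hB : (⋃ n, (fun x : WeakPower I o => x.1 n) '' D).Countable :=
    countable_iUnion fun n => hD.image _
  obtain ⟨H, hH, hHB⟩ := hlam _ hB
  have hT : IsGδ (⋂ n, (fun x : WeakPower I o => f (x.1 n)) ⁻¹' H) :=
    IsGδ.iInter fun n => hH.preimage (continuous_pi fun j => continuous_coord hf n j)
  have hTc : (⋂ n, (fun x : WeakPower I o => f (x.1 n)) ⁻¹' H).Countable := by
    refine (countable_setOf_forall_mem (o := o) hB).mono fun x hx => ?_
    exact fun n => hHB.subset (mem_iInter.1 hx n)
  have hDT : D ⊆ ⋂ n, (fun x : WeakPower I o => f (x.1 n)) ⁻¹' H := fun x hx =>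
    mem_iInter.2 fun n => hHB.symm.subset (mem_iUnion.2 ⟨n, x, hx, rfl⟩)
  have h := hT.inter (hTc.mono sdiff_subset : (_ \ D).Countable).isGδ_compl
  rwa [← Set.sdiff_eq, sdiff_sdiff_cancel_left hDT] at h

theorem exists_closed_copy [Uncountable I] [T2Space (WeakPower I o)]
    (hf : IsInducing (code f : WeakPower I o → ℕ → ℕ)) {E : Set (WeakPower I o)}
    (hE : E.Countable) {U : Set (WeakPower I o)} (hU : IsOpen U) (hne : U.Nonempty) :
    ∃ φ : WeakPower I o → WeakPower I o, IsClosedEmbedding φ ∧ ∀ x, φ x ∈ U ∧ φ x ∉ E := by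
  obtain ⟨x₀, hx₀⟩ := hne
  obtain ⟨N, hN⟩ := hf.exists_forall_lt_eq_imp_mem (hU.mem_nhds hx₀)
  obtain ⟨i, hi⟩ : ∃ i, i ∉ (fun x : WeakPower I o => x.1 N) '' E := by
    by_contra! h
    exact not_countable_univ ((hE.image _).mono fun i _ => h i)
  refine ⟨splice x₀ N i, isClosedEmbedding_splice hf x₀ N i, fun x => ⟨hN _ fun k hk => ?_,
    fun hx => hi ⟨_, hx, by simp [splice]⟩⟩⟩
  simp [code, splice, (Nat.unpair_left_le k).trans_lt hk]

end Topology

end WeakPower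

end CountableDenseHomogeneous

open CountableDenseHomogeneous

/-- For every cardinal `κ` with `ω₁ ≤ κ ≤ 𝔟` there is a separable metrizable CDH space
of cardinality `κ` which is meager in itself. -/
theorem exists_CDH_meager_of_le_bounding (κ : Cardinal)
    (h₁ : Cardinal.aleph 1 ≤ κ) (h₂ : κ ≤ boundingNumber) :
    ∃ (X : Type) (t : TopologicalSpace X), @SeparableSpace X t ∧ @MetrizableSpace X t ∧
      @IsCDH X t ∧ @IsMeagre X t Set.univ ∧ Cardinal.mk X = κ := by
  have h0 : Cardinal.aleph0 < κ := by
    refine lt_of_lt_of_le ?_ h₁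
    rw [← Cardinal.aleph_zero]
    exact Cardinal.aleph_lt_aleph.2 zero_lt_one
  obtain ⟨I, f, hinj, hI, hlam⟩ := exists_lambda_set h0 h₂
  have : Uncountable I := Cardinal.aleph0_lt_mk_iff.1 (hI ▸ h0)
  obtain ⟨o⟩ : Nonempty I := inferInstance
  let t : TopologicalSpace (WeakPower I o) := .induced (WeakPower.code f) inferInstance
  have hf : IsEmbedding (WeakPower.code f : WeakPower I o → ℕ → ℕ) :=
    ⟨⟨rfl⟩, WeakPower.code_injective hinj⟩
  have : MetrizableSpace (WeakPower I o) := hf.metrizableSpace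
  have : SecondCountableTopology (WeakPower I o) := hf.secondCountableTopology
  have hGδ : ∀ D : Set (WeakPower I o), D.Countable → IsGδ D := fun D hD =>
    WeakPower.isGδ_of_countable hf.isInducing hlam hD
  have hcopy := fun (E : Set (WeakPower I o)) (hE : E.Countable) (U : Set (WeakPower I o))
    (hU : IsOpen U) (hne : U.Nonempty) => WeakPower.exists_closed_copy hf.isInducing hE hU hne
  exact ⟨WeakPower I o, t, inferInstance, inferInstance,
    isCDH_of_closed_copies (.ofInducing hf.isInducing) hGδ hcopy,
    isMeagre_univ_of_closed_copies hGδ hcopy, (WeakPower.mk_eq (hI ▸ h0.le)).trans hI⟩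
end

section
/- Let X ⊆ 2^ω be an uncountable saturated λ'-set. Then for every pair D₀, D₁ of countable dense subsets of X and every pair E₀, E₁ of countable dense subsets of 2^ω \ X, there is a homeomorphism h : 2^ω → 2^ω such that h[D₀] = D₁, h[E₀] = E₁ and h[X] = X. -/
open Set

/-- The Cantor space `2^ω`. -/
abbrev Cantor : Type := ℕ → Bool

/-- `X ⊆ 2^ω` is a λ'-set if every countable `Y ⊆ 2^ω` is a relative Gδ-set in `X ∪ Y`. -/
def IsLambdaPrimeSet (X : Set Cantor) : Prop :=
  ∀ Y : Set Cantor, Y.Countable → ∃ G : Set Cantor, IsGδ G ∧ Y = G ∩ (X ∪ Y)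

/-- Tail equivalence on the Cantor space. -/
def TailEquiv (x y : Cantor) : Prop :=
  ∃ m n : ℕ, ∀ k : ℕ, x (m + k) = y (n + k)

/-- The saturation of a set under tail equivalence. -/
def saturation (X : Set Cantor) : Set Cantor :=
  {y | ∃ x ∈ X, TailEquiv y x}

/-- A set is saturated if it equals its tail-equivalence saturation. -/
def Saturated (X : Set Cantor) : Prop := X = saturation X

open Filter Topology

section EventualEquality

lemma Saturated.mem_of_eventuallyEq {X : Set Cantor} (hX : Saturated X) {x y : Cantor}
    (hx : x ∈ X) (h : y =ᶠ[atTop] x) : y ∈ X := by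
  rw [hX]
  obtain ⟨n, hn⟩ := eventually_atTop.1 h
  exact ⟨x, hx, n, n, fun k => hn _ (Nat.le_add_right n k)⟩

lemma countable_setOf_eventuallyEq (x : Cantor) : {y : Cantor | y =ᶠ[atTop] x}.Countable := by
  refine (countable_range fun (s : Finset ℕ) (i : ℕ) => xor (x i) (decide (i ∈ s))).mono ?_
  intro y hy
  obtain ⟨n, hn⟩ := eventually_atTop.1 hy
  refine ⟨(Finset.range n).filter fun i => y i ≠ x i, ?_⟩
  funext i
  by_cases hi : y i = x i
  · simp [hi]
  · have : i < n := by
      by_contra h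
      exact hi (hn i (not_lt.1 h))
    cases hx : x i <;> cases hy : y i <;> simp_all

lemma setOf_agree_mem_nhds (x : Cantor) (n : ℕ) : {y : Cantor | ∀ i < n, y i = x i} ∈ 𝓝 x := by
  have h : ∀ i ∈ Finset.range n, ∀ᶠ y : Cantor in 𝓝 x, y i = x i := fun i _ =>
    (continuous_apply i).continuousAt.eventually_mem ((isOpen_discrete {x i}).mem_nhds rfl)
  filter_upwards [(Finset.eventually_all _).2 h] with y hy i hi
  exact hy i (Finset.mem_range.2 hi)

lemma exists_setOf_agree_subset {x : Cantor} {U : Set Cantor} (hU : U ∈ 𝓝 x) :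
    ∃ n : ℕ, {y : Cantor | ∀ i < n, y i = x i} ⊆ U := by
  obtain ⟨V, hVU, hV, hx⟩ := mem_nhds_iff.1 hU
  obtain ⟨I, u, hu, hI⟩ := isOpen_pi_iff.1 hV x hx
  obtain ⟨n, hn⟩ := I.exists_nat_subset_range
  refine ⟨n, fun y hy => hVU (hI fun i hi => ?_)⟩
  rw [hy i (Finset.mem_range.1 (hn hi))]
  exact (hu i hi).2

lemma dense_of_eventuallyEq {S : Set Cantor} {x : Cantor}
    (hS : ∀ y : Cantor, y =ᶠ[atTop] x → y ∈ S) : Dense S := by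
  intro z
  rw [mem_closure_iff_nhds]
  intro U hU
  obtain ⟨n, hn⟩ := exists_setOf_agree_subset hU
  refine ⟨fun i => if i < n then z i else x i, hn fun i hi => by simp [hi], hS _ ?_⟩
  filter_upwards [eventually_ge_atTop n] with i hi
  simp [not_lt.2 hi]

end EventualEquality

section LevelPreserving

/-- A map of the Cantor space is level-preserving if the first `n` values of the image depend only
on the first `n` values of the argument. -/
def LevelPreserving (f : Cantor → Cantor) : Prop :=
  ∀ n x y, (∀ i < n, x i = y i) → ∀ i < n, f x i = f y i

lemma LevelPreserving.continuous {f : Cantor → Cantor} (hf : LevelPreserving f) :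
    Continuous f := by
  refine continuous_pi fun j => ?_
  refine IsLocallyConstant.continuous ((IsLocallyConstant.iff_eventually_eq _).2 fun x => ?_)
  filter_upwards [setOf_agree_mem_nhds x (j + 1)] with y hy
  exact hf (j + 1) y x hy j (Nat.lt_succ_self j)

/-- The map taking `a` to `c` which, on a point first differing from `a` at place `k`, replaces the
first `k + 1` values so that the image first differs from `c` at place `k`. -/
def shiftMap (a c x : Cantor) : Cantor :=
  fun j => if ∀ i < j, x i = a i then xor (x j) (xor (a j) (c j)) else x j

lemma shiftMap_self (a c : Cantor) : shiftMap a c a = c := by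
  funext j
  simp [shiftMap]

lemma shiftMap_agree_iff (a c x : Cantor) (n : ℕ) :
    (∀ i < n, shiftMap a c x i = c i) ↔ ∀ i < n, x i = a i := by
  induction n with
  | zero => simp
  | succ n ih =>
    rw [Nat.forall_lt_succ_right, Nat.forall_lt_succ_right, ih]
    refine and_congr_right fun h => ?_
    simp only [shiftMap, if_pos h]
    cases x n <;> cases a n <;> cases c n <;> simp

lemma shiftMap_shiftMap (a c x : Cantor) : shiftMap c a (shiftMap a c x) = x := by
  funext j
  have h := shiftMap_agree_iff a c x j
  by_cases hx : ∀ i < j, x i = a i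
  · rw [shiftMap, if_pos (h.2 hx), shiftMap, if_pos hx]
    cases x j <;> cases a j <;> cases c j <;> rfl
  · rw [shiftMap, if_neg (mt h.1 hx), shiftMap, if_neg hx]

lemma levelPreserving_shiftMap (a c : Cantor) : LevelPreserving (shiftMap a c) := by
  intro n x y h i hi
  have hiff : (∀ k < i, x k = a k) ↔ ∀ k < i, y k = a k :=
    forall₂_congr fun k hk => by rw [h k (hk.trans hi)]
  simp only [shiftMap, hiff, h i hi]

lemma shiftMap_eventuallyEq {a c x : Cantor} (hx : x ≠ a) : shiftMap a c x =ᶠ[atTop] x := by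
  obtain ⟨k, hk⟩ := Function.ne_iff.1 hx
  filter_upwards [eventually_gt_atTop k] with j hj
  exact if_neg fun h => hk (h k hj)

lemma shiftMap_eq_self {a c x : Cantor} {n : ℕ} (hac : ∀ i < n, c i = a i)
    (hx : ¬ ∀ i < n, x i = a i) : shiftMap a c x = x := by
  funext j
  by_cases h : ∀ i < j, x i = a i
  · have hj : j < n := by
      by_contra hj
      exact hx fun i hi => h i (hi.trans_le (not_lt.1 hj))
    rw [shiftMap, if_pos h, hac j hj]
    simp
  · exact if_neg h

/-- `shiftMap a c` as a permutation, with inverse `shiftMap c a`. -/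
def shiftPerm (a c : Cantor) : Equiv.Perm Cantor where
  toFun := shiftMap a c
  invFun := shiftMap c a
  left_inv := shiftMap_shiftMap a c
  right_inv := shiftMap_shiftMap c a

end LevelPreserving

section BackAndForth

/-- A level-preserving permutation `f` that is eventually equal to the identity at each point off a
finite set `P`, on which its graph is contained in `R`. -/
structure IsApprox (R : Cantor → Cantor → Prop) (f : Equiv.Perm Cantor) (P : Set Cantor) :
    Prop where
  levelPreserving : LevelPreserving f
  levelPreserving_symm : LevelPreserving f.symm
  finite : P.Finite
  eventuallyEq : ∀ x ∉ P, f x =ᶠ[atTop] x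
  rel : ∀ x ∈ P, R x (f x)

/-- `(g, P')` refines `(f, P)`: nothing changes on `P`, on `K` or on the preimage of `K`, and the
first `n` values never change. -/
structure Refines (K : Set Cantor) (n : ℕ) (f g : Equiv.Perm Cantor) (P P' : Set Cantor) :
    Prop where
  subset : P ⊆ P'
  eqOn : ∀ x ∈ P, g x = f x
  eq_of_mem : ∀ x ∈ K, g x = f x
  eq_of_apply_mem : ∀ x, f x ∈ K → g x = f x
  agree : ∀ x, ∀ i < n, g x i = f x i

variable {R : Cantor → Cantor → Prop} {f g k : Equiv.Perm Cantor} {P P' P'' K : Set Cantor} {n : ℕ}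

lemma Refines.refl (K : Set Cantor) (n : ℕ) (f : Equiv.Perm Cantor) (P : Set Cantor) :
    Refines K n f f P P :=
  ⟨Subset.rfl, fun _ _ => rfl, fun _ _ => rfl, fun _ _ => rfl, fun _ _ _ => rfl⟩

lemma Refines.trans (h : Refines K n f g P P') (h' : Refines K n g k P' P'') :
    Refines K n f k P P'' where
  subset := h.subset.trans h'.subset
  eqOn x hx := (h'.eqOn x (h.subset hx)).trans (h.eqOn x hx)
  eq_of_mem x hx := (h'.eq_of_mem x hx).trans (h.eq_of_mem x hx)
  eq_of_apply_mem x hx := by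
    have hg := h.eq_of_apply_mem x hx
    rw [h'.eq_of_apply_mem x (hg ▸ hx), hg]
  agree x i hi := (h'.agree x i hi).trans (h.agree x i hi)

lemma Refines.mono {K' : Set Cantor} {n' : ℕ} (h : Refines K n f g P P') (hK : K' ⊆ K)
    (hn : n' ≤ n) : Refines K' n' f g P P' where
  subset := h.subset
  eqOn := h.eqOn
  eq_of_mem x hx := h.eq_of_mem x (hK hx)
  eq_of_apply_mem x hx := h.eq_of_apply_mem x (hK hx)
  agree x i hi := h.agree x i (hi.trans_le hn)

lemma IsApprox.symm (h : IsApprox R f P) : IsApprox (flip R) f.symm (f '' P) where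
  levelPreserving := h.levelPreserving_symm
  levelPreserving_symm := h.levelPreserving
  finite := h.finite.image f
  eventuallyEq y hy := by
    have hx : f.symm y ∉ P := fun hx => hy ⟨_, hx, f.apply_symm_apply y⟩
    simpa using (h.eventuallyEq _ hx).symm
  rel := by
    rintro _ ⟨x, hx, rfl⟩
    simpa [flip] using h.rel x hx

lemma Refines.symm (hf : IsApprox R f P) (h : Refines K n f g P P') :
    Refines K n f.symm g.symm (f '' P) (g '' P') where
  subset := by
    rintro _ ⟨x, hx, rfl⟩
    exact ⟨x, h.subset hx, h.eqOn x hx⟩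
  eqOn := by
    rintro _ ⟨x, hx, rfl⟩
    rw [Equiv.symm_apply_apply, Equiv.symm_apply_eq, h.eqOn x hx]
  eq_of_mem y hy := by
    rw [Equiv.symm_apply_eq, h.eq_of_apply_mem _ (by simpa using hy), Equiv.apply_symm_apply]
  eq_of_apply_mem y hy := by
    rw [Equiv.symm_apply_eq, h.eq_of_mem _ hy, Equiv.apply_symm_apply]
  agree y i hi := by
    have := hf.levelPreserving_symm n _ _ (h.agree (g.symm y)) i hi
    simpa using this.symm

lemma IsApprox.exists_refines_of_dense {Q : Set Cantor} (hQ : ∀ x ∈ Q, ∀ y, y =ᶠ[atTop] x → y ∈ Q)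
    (hRQ : ∀ x y, R x y → x ∈ Q ∧ y ∈ Q) (hK : IsClosed K) (hKQ : Disjoint K Q)
    (hf : IsApprox R f P) {a : Cantor} (ha : Dense {y | R a y}) (n : ℕ) :
    ∃ g P', IsApprox R g P' ∧ Refines K n f g P P' ∧ a ∈ P' := by
  by_cases haP : a ∈ P
  · exact ⟨f, P, hf, Refines.refl K n f P, haP⟩
  have haQ : a ∈ Q := by
    obtain ⟨y, hy⟩ := ha.nonempty
    exact (hRQ a y hy).1
  have haK : a ∉ K := fun h => hKQ.notMem_of_mem_left h haQ
  have hfaK : f a ∉ K := fun h => hKQ.notMem_of_mem_left h (hQ a haQ _ (hf.eventuallyEq a haP))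
  have hcl : IsClosed (P ∪ (K ∪ f ⁻¹' K)) :=
    hf.finite.isClosed.union (hK.union (hK.preimage hf.levelPreserving.continuous))
  obtain ⟨m, hm⟩ := exists_setOf_agree_subset
    (hcl.isOpen_compl.mem_nhds (by simp [haP, haK, hfaK] : a ∈ (P ∪ (K ∪ f ⁻¹' K))ᶜ))
  obtain ⟨N, hmN, hnN⟩ : ∃ N, m ≤ N ∧ n ≤ N := ⟨max m n, le_max_left _ _, le_max_right _ _⟩
  have hout : ∀ x ∈ P ∪ (K ∪ f ⁻¹' K), ¬ ∀ i < N, x i = a i := fun x hx h =>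
    hm (fun i hi => h i (hi.trans_le hmN)) hx
  obtain ⟨b, hbN, hab⟩ := mem_closure_iff_nhds.1 (ha (f a)) _ (setOf_agree_mem_nhds (f a) N)
  obtain ⟨c, rfl⟩ := f.surjective b
  have hc : ∀ i < N, c i = a i := by
    simpa using hf.levelPreserving_symm N _ _ hbN
  have hid : ∀ x, (¬ ∀ i < N, x i = a i) → f (shiftMap a c x) = f x := fun x hx => by
    rw [shiftMap_eq_self hc hx]
  refine ⟨(shiftPerm a c).trans f, insert a P, ⟨?_, ?_, hf.finite.insert a, ?_, ?_⟩,
    ⟨subset_insert a P, ?_, ?_, ?_, ?_⟩, mem_insert a P⟩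
  · exact fun l x y h => hf.levelPreserving l _ _ (levelPreserving_shiftMap a c l x y h)
  · exact fun l x y h => levelPreserving_shiftMap c a l _ _ (hf.levelPreserving_symm l x y h)
  · intro x hx
    obtain ⟨hxa, hxP⟩ : x ≠ a ∧ x ∉ P := by simpa using hx
    refine (hf.eventuallyEq _ fun hP => ?_).trans (shiftMap_eventuallyEq hxa)
    by_cases h : ∀ i < N, x i = a i
    · refine hout _ (Or.inl hP) fun i hi => ?_
      exact ((shiftMap_agree_iff a c x N).2 h i hi).trans (hc i hi)
    · rw [shiftPerm, Equiv.coe_fn_mk, shiftMap_eq_self hc h] at hP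
      exact hxP hP
  · rintro x (rfl | hx)
    · change R x (f (shiftMap x c x))
      rwa [shiftMap_self]
    · change R x (f (shiftMap a c x))
      rw [hid x (hout x (Or.inl hx))]
      exact hf.rel x hx
  · exact fun x hx => hid x (hout x (Or.inl hx))
  · exact fun x hx => hid x (hout x (Or.inr (Or.inl hx)))
  · exact fun x hx => hid x (hout x (Or.inr (Or.inr hx)))
  · intro x i hi
    by_cases h : ∀ i < N, x i = a i
    · refine hf.levelPreserving N _ _ (fun j hj => ?_) i (hi.trans_le hnN)
      rw [h j hj, ← hc j hj]
      exact (shiftMap_agree_iff a c x N).2 h j hj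
    · exact congrFun (hid x h) i

lemma IsApprox.exists_refines {Q : Set Cantor} (hQ : ∀ x ∈ Q, ∀ y, y =ᶠ[atTop] x → y ∈ Q)
    (hRQ : ∀ x y, R x y → x ∈ Q ∧ y ∈ Q) (hK : IsClosed K) (hKQ : Disjoint K Q)
    (hf : IsApprox R f P) {a b : Cantor} (ha : Dense {y | R a y}) (hb : Dense {x | R x b}) (n : ℕ) :
    ∃ g P', IsApprox R g P' ∧ Refines K n f g P P' ∧ a ∈ P' ∧ g.symm b ∈ P' := by
  obtain ⟨g, P', hg, hfg, haP⟩ := hf.exists_refines_of_dense hQ hRQ hK hKQ ha n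
  obtain ⟨k, P'', hk, hgk, hbP⟩ := hg.symm.exists_refines_of_dense (R := flip R) hQ
    (fun x y h => (hRQ y x h).symm) hK hKQ hb n
  have hgk' := hgk.symm hg.symm
  rw [Equiv.symm_symm, Equiv.symm_image_image] at hgk'
  exact ⟨k.symm, k '' P'', hk.symm, hfg.trans hgk', hgk'.subset haP, b, hbP, rfl⟩

lemma exists_seq_isApprox {Q A B : Set Cantor} {K : ℕ → Set Cantor}
    (hQ : ∀ x ∈ Q, ∀ y, y =ᶠ[atTop] x → y ∈ Q) (hRQ : ∀ x y, R x y → x ∈ Q ∧ y ∈ Q)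
    (hK : ∀ n, IsClosed (K n)) (hKQ : ∀ n, Disjoint (K n) Q)
    (hA : A.Countable) (hB : B.Countable) (hA₀ : A.Nonempty) (hB₀ : B.Nonempty)
    (hAR : ∀ a ∈ A, Dense {y | R a y}) (hBR : ∀ b ∈ B, Dense {x | R x b}) :
    ∃ (f : ℕ → Equiv.Perm Cantor) (P : ℕ → Set Cantor),
      (∀ n, IsApprox R (f n) (P n)) ∧
      (∀ n, Refines (K n) n (f n) (f (n + 1)) (P n) (P (n + 1))) ∧
      (∀ a ∈ A, ∃ n, a ∈ P n) ∧ ∀ b ∈ B, ∃ n, (f n).symm b ∈ P n := by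
  obtain ⟨α, rfl⟩ := hA.exists_eq_range hA₀
  obtain ⟨β, rfl⟩ := hB.exists_eq_range hB₀
  have hstep (n : ℕ) (s : {s : Equiv.Perm Cantor × Set Cantor // IsApprox R s.1 s.2}) :
      ∃ t : {s : Equiv.Perm Cantor × Set Cantor // IsApprox R s.1 s.2},
        Refines (K n) n s.1.1 t.1.1 s.1.2 t.1.2 ∧ α n ∈ t.1.2 ∧ t.1.1.symm (β n) ∈ t.1.2 := by
    obtain ⟨g, P', hg, h⟩ := s.2.exists_refines hQ hRQ (hK n) (hKQ n)
      (hAR _ ⟨n, rfl⟩) (hBR _ ⟨n, rfl⟩) n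
    exact ⟨⟨(g, P'), hg⟩, h⟩
  choose next hnext using hstep
  have h₀ : IsApprox R (Equiv.refl Cantor) ∅ :=
    ⟨fun _ _ _ h => h, fun _ _ _ h => h, finite_empty, fun _ _ => EventuallyEq.rfl, by simp⟩
  let s : ℕ → {s : Equiv.Perm Cantor × Set Cantor // IsApprox R s.1 s.2} := fun n =>
    Nat.rec ⟨(Equiv.refl Cantor, ∅), h₀⟩ next n
  refine ⟨fun n => (s n).1.1, fun n => (s n).1.2, fun n => (s n).2, fun n => (hnext n (s n)).1,
    ?_, ?_⟩
  · rintro _ ⟨n, rfl⟩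
    exact ⟨n + 1, (hnext n (s n)).2.1⟩
  · rintro _ ⟨n, rfl⟩
    exact ⟨n + 1, (hnext n (s n)).2.2⟩

/-- The coordinatewise limit of a sequence of maps whose `n`-th step fixes the first `n` values. -/
def coordLimit (f : ℕ → Cantor → Cantor) : Cantor → Cantor :=
  fun x j => f (j + 1) x j

lemma coordLimit_agree {f : ℕ → Cantor → Cantor} (hf : ∀ n x, ∀ i < n, f (n + 1) x i = f n x i)
    (n : ℕ) (x : Cantor) : ∀ i < n, coordLimit f x i = f n x i := by
  intro i hi
  induction n, (hi : i + 1 ≤ n) using Nat.le_induction with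
  | base => rfl
  | succ n hn ih => rw [hf n x i hn, ih]

lemma coordLimit_eq_of_forall_ge {f : ℕ → Cantor → Cantor}
    (hf : ∀ n x, ∀ i < n, f (n + 1) x i = f n x i) {n : ℕ} {x y : Cantor}
    (h : ∀ m ≥ n, f m x = y) : coordLimit f x = y := by
  funext i
  rw [coordLimit_agree hf (max n (i + 1)) x i (by omega), h _ (le_max_left _ _)]

lemma levelPreserving_coordLimit {f : ℕ → Cantor → Cantor} (h : ∀ n, LevelPreserving (f n)) :
    LevelPreserving (coordLimit f) := fun _ x y hxy i hi =>
  h (i + 1) (i + 1) x y (fun j hj => hxy j (by omega)) i (Nat.lt_succ_self i)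

lemma coordLimit_coordLimit {f g : ℕ → Cantor → Cantor} (h : ∀ n, LevelPreserving (f n))
    (hf : ∀ n x, ∀ i < n, f (n + 1) x i = f n x i) (hg : ∀ n x, ∀ i < n, g (n + 1) x i = g n x i)
    (hfg : ∀ n, Function.RightInverse (g n) (f n)) (y : Cantor) :
    coordLimit f (coordLimit g y) = y := by
  funext i
  rw [coordLimit_agree hf (i + 1) _ i (Nat.lt_succ_self i),
    h (i + 1) (i + 1) _ _ (coordLimit_agree hg (i + 1) y) i (Nat.lt_succ_self i), hfg]

theorem exists_homeomorph_rel_of_dense {Q A B : Set Cantor} {K : ℕ → Set Cantor}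
    (hQ : ∀ x ∈ Q, ∀ y, y =ᶠ[atTop] x → y ∈ Q) (hRQ : ∀ x y, R x y → x ∈ Q ∧ y ∈ Q)
    (hKmono : Monotone K) (hK : ∀ n, IsClosed (K n)) (hKQ : ∀ n, Disjoint (K n) Q)
    (hA : A.Countable) (hB : B.Countable) (hA₀ : A.Nonempty) (hB₀ : B.Nonempty)
    (hAR : ∀ a ∈ A, Dense {y | R a y}) (hBR : ∀ b ∈ B, Dense {x | R x b}) :
    ∃ h : Cantor ≃ₜ Cantor, (∀ a ∈ A, R a (h a)) ∧ (∀ b ∈ B, R (h.symm b) b) ∧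
      (∀ n, ∀ x ∈ K n, h x =ᶠ[atTop] x) ∧ ∀ n, ∀ y ∈ K n, h.symm y =ᶠ[atTop] y := by
  obtain ⟨f, P, hf, hfP, hAP, hBP⟩ := exists_seq_isApprox hQ hRQ hK hKQ hA hB hA₀ hB₀ hAR hBR
  have hagree : ∀ n x, ∀ i < n, f (n + 1) x i = f n x i := fun n => (hfP n).agree
  have hagree' : ∀ n x, ∀ i < n, (f (n + 1)).symm x i = (f n).symm x i := fun n =>
    ((hfP n).symm (hf n)).agree
  have hlp n := (hf n).levelPreserving
  have hlp' n := (hf n).levelPreserving_symm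
  let h : Cantor ≃ₜ Cantor :=
    { toFun := coordLimit fun n => f n
      invFun := coordLimit fun n => (f n).symm
      left_inv := coordLimit_coordLimit hlp' hagree' hagree fun n => (f n).symm_apply_apply
      right_inv := coordLimit_coordLimit hlp hagree hagree' fun n => (f n).apply_symm_apply
      continuous_toFun := (levelPreserving_coordLimit hlp).continuous
      continuous_invFun := (levelPreserving_coordLimit hlp').continuous }
  have hrefines : ∀ n, ∀ m ≥ n, Refines (K n) n (f n) (f m) (P n) (P m) := by
    intro n m hm
    induction m, hm using Nat.le_induction with
    | base => exact Refines.refl _ _ _ _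
    | succ m hm ih => exact ih.trans ((hfP m).mono (hKmono hm) hm)
  have hP : ∀ n, ∀ x ∈ P n, h x = f n x := fun n x hx =>
    coordLimit_eq_of_forall_ge hagree fun m hm => (hrefines n m hm).eqOn x hx
  have hKf : ∀ n, ∀ x ∈ K n, h x = f n x := fun n x hx =>
    coordLimit_eq_of_forall_ge hagree fun m hm => (hrefines n m hm).eq_of_mem x hx
  have hKf' : ∀ n, ∀ x, f n x ∈ K n → h x = f n x := fun n x hx =>
    coordLimit_eq_of_forall_ge hagree fun m hm => (hrefines n m hm).eq_of_apply_mem x hx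
  refine ⟨h, fun a ha => ?_, fun b hb => ?_, fun n x hx => ?_, fun n y hy => ?_⟩
  · obtain ⟨n, hn⟩ := hAP a ha
    rw [hP n a hn]
    exact (hf n).rel a hn
  · obtain ⟨n, hn⟩ := hBP b hb
    have hb' : h.symm b = (f n).symm b := by
      rw [Homeomorph.symm_apply_eq, hP n _ hn, Equiv.apply_symm_apply]
    rw [hb']
    simpa using (hf n).rel _ hn
  · rw [hKf n x hx]
    refine (hf n).eventuallyEq x fun hxP => ?_
    exact (hKQ n).notMem_of_mem_left hx (hRQ _ _ ((hf n).rel x hxP)).1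
  · have hy' : h.symm y = (f n).symm y := by
      rw [Homeomorph.symm_apply_eq, hKf' n _ (by simpa using hy), Equiv.apply_symm_apply]
    have hyP : (f n).symm y ∉ P n := fun hyP => by
      have := (hRQ _ _ ((hf n).rel _ hyP)).2
      rw [Equiv.apply_symm_apply] at this
      exact (hKQ n).notMem_of_mem_left hy this
    rw [hy']
    simpa using ((hf n).eventuallyEq _ hyP).symm

end BackAndForth

section LambdaPrime

lemma IsLambdaPrimeSet.exists_closed_cover {X Q : Set Cantor} (hX : IsLambdaPrimeSet X)
    (hQ : Q.Countable) : ∃ K : ℕ → Set Cantor, Monotone K ∧ (∀ n, IsClosed (K n)) ∧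
      (∀ n, Disjoint (K n) Q) ∧ ∀ x ∈ X, x ∉ Q → ∃ n, x ∈ K n := by
  obtain ⟨G, hG, hQG⟩ := hX Q hQ
  obtain ⟨U, hU, rfl⟩ := isGδ_iff_eq_iInter_nat.1 hG
  refine ⟨fun n => ⋃ i ∈ Iic n, (U i)ᶜ, fun m n hmn => ?_, fun n => ?_, fun n => ?_, ?_⟩
  · exact biUnion_subset_biUnion_left (Iic_subset_Iic.2 hmn)
  · exact (finite_Iic n).isClosed_biUnion fun i _ => (hU i).isClosed_compl
  · rw [Set.disjoint_left]
    intro x hx hxQ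
    obtain ⟨i, -, hi⟩ := mem_iUnion₂.1 hx
    rw [hQG] at hxQ
    exact hi (mem_iInter.1 hxQ.1 i)
  · intro x hxX hxQ
    have hx : x ∉ ⋂ n, U n := fun h => hxQ (hQG ▸ ⟨h, Or.inl hxX⟩)
    obtain ⟨i, hi⟩ : ∃ i, x ∉ U i := by simpa using hx
    exact ⟨i, mem_iUnion₂.2 ⟨i, mem_Iic.2 le_rfl, hi⟩⟩

lemma not_isLambdaPrimeSet_univ : ¬ IsLambdaPrimeSet (univ : Set Cantor) := by
  intro h
  let x : Cantor := fun _ => false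
  let Y : Set Cantor := {y | y =ᶠ[atTop] x}
  have hY : Y.Countable := countable_setOf_eventuallyEq x
  obtain ⟨G, hG, hYG⟩ := h Y hY
  obtain rfl : Y = G := by simpa using hYG
  obtain ⟨z, hz⟩ : ∃ z, z ∉ Y := by
    by_contra! hall
    have : Uncountable Cantor :=
      Cardinal.aleph0_lt_mk_iff.1 (by simpa using Cardinal.cantor Cardinal.aleph0)
    exact Set.not_countable_univ (hY.mono fun z _ => hall z)
  have hdense : Dense Yᶜ := dense_of_eventuallyEq (x := z) fun y hy hyY => hz (hy.symm.trans hyY)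
  have := (dense_of_eventuallyEq (S := Y) (x := x) fun _ hy => hy).inter_of_Gδ hG
    hY.isGδ_compl hdense
  rw [inter_compl_self] at this
  simpa using this.nonempty

lemma Saturated.dense {X : Set Cantor} (hX : Saturated X) (hne : X.Nonempty) : Dense X := by
  obtain ⟨x, hx⟩ := hne
  exact dense_of_eventuallyEq fun y hy => hX.mem_of_eventuallyEq hx hy

lemma Saturated.dense_compl {X : Set Cantor} (hX : Saturated X) (hne : Xᶜ.Nonempty) :
    Dense Xᶜ := by
  obtain ⟨x, hx⟩ := hne
  exact dense_of_eventuallyEq fun y hy hyX => hx (hX.mem_of_eventuallyEq hyX hy.symm)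

/-- Every countable set is contained in a countable set `Q` closed under eventual equality, such
that removing the given set from `X ∩ Q` leaves a dense set. -/
lemma Saturated.exists_countable_superset {X C : Set Cantor} (hX : Saturated X)
    (hunc : ¬ X.Countable) (hC : C.Countable) : ∃ Q : Set Cantor, Q.Countable ∧ C ⊆ Q ∧
      (∀ x ∈ Q, ∀ y, y =ᶠ[atTop] x → y ∈ Q) ∧ Dense ((X ∩ Q) \ C) := by
  have hsat : ∀ S : Set Cantor, S.Countable →
      (⋃ x ∈ S, {y : Cantor | y =ᶠ[atTop] x}).Countable := fun S hS =>
    hS.biUnion fun x _ => countable_setOf_eventuallyEq x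
  obtain ⟨z, hzX, hz⟩ : ∃ z ∈ X, z ∉ ⋃ x ∈ C, {y : Cantor | y =ᶠ[atTop] x} := by
    by_contra! h
    exact hunc ((hsat C hC).mono h)
  refine ⟨⋃ x ∈ insert z C, {y : Cantor | y =ᶠ[atTop] x}, hsat _ (hC.insert z),
    fun x hx => mem_iUnion₂.2 ⟨x, Or.inr hx, EventuallyEq.rfl⟩, fun x hx y hy => ?_,
    dense_of_eventuallyEq (x := z) fun y hy => ⟨⟨hX.mem_of_eventuallyEq hzX hy,
      mem_iUnion₂.2 ⟨z, Or.inl rfl, hy⟩⟩, fun hyC => hz (mem_iUnion₂.2 ⟨y, hyC, hy.symm⟩)⟩⟩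
  obtain ⟨w, hw, hxw⟩ := mem_iUnion₂.1 hx
  exact mem_iUnion₂.2 ⟨w, hw, hy.trans hxw⟩

end LambdaPrime

/-- For an uncountable saturated λ'-set `X ⊆ 2^ω`, any countable dense subsets
`D₀, D₁` of `X` and countable dense subsets `E₀, E₁` of `2^ω \ X` can be matched
simultaneously by an autohomeomorphism of `2^ω` preserving `X`. -/
theorem relatively_CDH_of_saturated_lambdaPrime (X : Set Cantor)
    (hunc : ¬ X.Countable) (hsat : Saturated X) (hlam : IsLambdaPrimeSet X)
    (D₀ D₁ E₀ E₁ : Set Cantor)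
    (hD₀X : D₀ ⊆ X) (hD₁X : D₁ ⊆ X) (hD₀c : D₀.Countable) (hD₁c : D₁.Countable)
    (hD₀d : X ⊆ closure D₀) (hD₁d : X ⊆ closure D₁)
    (hE₀X : E₀ ⊆ Xᶜ) (hE₁X : E₁ ⊆ Xᶜ) (hE₀c : E₀.Countable) (hE₁c : E₁.Countable)
    (hE₀d : Xᶜ ⊆ closure E₀) (hE₁d : Xᶜ ⊆ closure E₁) :
    ∃ h : Cantor ≃ₜ Cantor, h '' D₀ = D₁ ∧ h '' E₀ = E₁ ∧ h '' X = X := by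
  have hXne : X.Nonempty := nonempty_iff_ne_empty.2 fun h => hunc (h ▸ countable_empty)
  have hXcne : Xᶜ.Nonempty := nonempty_compl.2 fun h => not_isLambdaPrimeSet_univ (h ▸ hlam)
  have hX := hsat.dense hXne
  have hXc := hsat.dense_compl hXcne
  have hD₀ : Dense D₀ := dense_closure.1 (hX.mono hD₀d)
  have hD₁ : Dense D₁ := dense_closure.1 (hX.mono hD₁d)
  have hE₀ : Dense E₀ := dense_closure.1 (hXc.mono hE₀d)
  have hE₁ : Dense E₁ := dense_closure.1 (hXc.mono hE₁d)
  obtain ⟨Q, hQc, hCQ, hQ, hQd⟩ := hsat.exists_countable_superset hunc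
    ((hD₀c.union hD₁c).union (hE₀c.union hE₁c))
  have hD₀Q : D₀ ⊆ Q := fun x hx => hCQ (Or.inl (Or.inl hx))
  have hD₁Q : D₁ ⊆ Q := fun x hx => hCQ (Or.inl (Or.inr hx))
  have hE₀Q : E₀ ⊆ Q := fun x hx => hCQ (Or.inr (Or.inl hx))
  have hE₁Q : E₁ ⊆ Q := fun x hx => hCQ (Or.inr (Or.inr hx))
  have hF₀ : Dense ((X ∩ Q) \ D₀) :=
    hQd.mono (sdiff_subset_sdiff_right fun x hx => Or.inl (Or.inl hx))
  have hF₁ : Dense ((X ∩ Q) \ D₁) :=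
    hQd.mono (sdiff_subset_sdiff_right fun x hx => Or.inl (Or.inr hx))
  obtain ⟨K, hKmono, hK, hKQ, hKX⟩ := hlam.exists_closed_cover hQc
  let R : Cantor → Cantor → Prop := fun x y =>
    (x ∈ D₀ ∧ y ∈ D₁) ∨ (x ∈ (X ∩ Q) \ D₀ ∧ y ∈ (X ∩ Q) \ D₁) ∨ (x ∈ E₀ ∧ y ∈ E₁)
  have hRQ : ∀ x y, R x y → x ∈ Q ∧ y ∈ Q := by
    rintro x y (⟨hx, hy⟩ | ⟨hx, hy⟩ | ⟨hx, hy⟩)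
    · exact ⟨hD₀Q hx, hD₁Q hy⟩
    · exact ⟨hx.1.2, hy.1.2⟩
    · exact ⟨hE₀Q hx, hE₁Q hy⟩
  have hRX : ∀ x y, R x y → (x ∈ X ↔ y ∈ X) := by
    rintro x y (⟨hx, hy⟩ | ⟨hx, hy⟩ | ⟨hx, hy⟩)
    · exact iff_of_true (hD₀X hx) (hD₁X hy)
    · exact iff_of_true hx.1.1 hy.1.1
    · exact iff_of_false (hE₀X hx) (hE₁X hy)
  have hRD : ∀ x y, R x y → (x ∈ D₀ ↔ y ∈ D₁) := by
    rintro x y (⟨hx, hy⟩ | ⟨hx, hy⟩ | ⟨hx, hy⟩)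
    · exact iff_of_true hx hy
    · exact iff_of_false hx.2 hy.2
    · exact iff_of_false (fun h => hE₀X hx (hD₀X h)) fun h => hE₁X hy (hD₁X h)
  have hRE : ∀ x y, R x y → (x ∈ E₀ ↔ y ∈ E₁) := by
    rintro x y (⟨hx, hy⟩ | ⟨hx, hy⟩ | ⟨hx, hy⟩)
    · exact iff_of_false (fun h => hE₀X h (hD₀X hx)) fun h => hE₁X h (hD₁X hy)
    · exact iff_of_false (fun h => hE₀X h hx.1.1) fun h => hE₁X h hy.1.1
    · exact iff_of_true hx hy
  obtain ⟨h, hA, hB, hKh, hKh'⟩ := exists_homeomorph_rel_of_dense (R := R)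
    (A := (X ∩ Q) ∪ E₀) (B := (X ∩ Q) ∪ E₁) hQ hRQ hKmono hK hKQ
    ((hQc.mono inter_subset_right).union hE₀c) ((hQc.mono inter_subset_right).union hE₁c)
    (hE₀.nonempty.mono subset_union_right) (hE₁.nonempty.mono subset_union_right)
    (by
      intro a ha
      by_cases haD : a ∈ D₀
      · exact hD₁.mono fun y hy => Or.inl ⟨haD, hy⟩
      · rcases ha with ha | ha
        · exact hF₁.mono fun y hy => Or.inr (Or.inl ⟨⟨ha, haD⟩, hy⟩)
        · exact hE₁.mono fun y hy => Or.inr (Or.inr ⟨ha, hy⟩))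
    (by
      intro b hb
      by_cases hbD : b ∈ D₁
      · exact hD₀.mono fun x hx => Or.inl ⟨hx, hbD⟩
      · rcases hb with hb | hb
        · exact hF₀.mono fun x hx => Or.inr (Or.inl ⟨hx, ⟨hb, hbD⟩⟩)
        · exact hE₀.mono fun x hx => Or.inr (Or.inr ⟨hx, hb⟩))
  have himage : ∀ S T : Set Cantor, (∀ x ∈ S, h x ∈ T) → (∀ y ∈ T, h.symm y ∈ S) →
      h '' S = T := fun S T hST hTS =>
    Subset.antisymm (image_subset_iff.2 hST) fun y hy => ⟨_, hTS y hy, h.apply_symm_apply y⟩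
  refine ⟨h, himage _ _ (fun x hx => ?_) fun y hy => ?_,
    himage _ _ (fun x hx => ?_) fun y hy => ?_, himage _ _ (fun x hx => ?_) fun y hy => ?_⟩
  · exact (hRD _ _ (hA x (Or.inl ⟨hD₀X hx, hD₀Q hx⟩))).1 hx
  · exact (hRD _ _ (hB y (Or.inl ⟨hD₁X hy, hD₁Q hy⟩))).2 hy
  · exact (hRE _ _ (hA x (Or.inr hx))).1 hx
  · exact (hRE _ _ (hB y (Or.inr hy))).2 hy
  · by_cases hxQ : x ∈ Q
    · exact (hRX _ _ (hA x (Or.inl ⟨hx, hxQ⟩))).1 hx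
    · obtain ⟨n, hn⟩ := hKX x hx hxQ
      exact hsat.mem_of_eventuallyEq hx (hKh n x hn)
  · by_cases hyQ : y ∈ Q
    · exact (hRX _ _ (hB y (Or.inl ⟨hy, hyQ⟩))).2 hy
    · obtain ⟨n, hn⟩ := hKX y hy hyQ
      exact hsat.mem_of_eventuallyEq hy (hKh' n y hn)
end

section
/- If X ⊆ 2^ω is a λ'-set, then no subset of 2^ω \ X that is closed in the subspace 2^ω \ X is homeomorphic to the space ℚ of rational numbers. -/
open Set

/-- A countable T₁ space without isolated points is not a Baire space. -/
theorem not_baireSpace_of_countable {Y : Type*} [TopologicalSpace Y] [T1Space Y] [Countable Y]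
    [Nonempty Y] [∀ y : Y, (nhdsWithin y {y}ᶜ).NeBot] : ¬ BaireSpace Y := by
  intro _
  obtain ⟨y, hy⟩ := nonempty_interior_of_iUnion_of_closed (f := fun y : Y => {y})
    (fun _ => isClosed_singleton) (iUnion_of_singleton Y)
  rw [interior_singleton] at hy
  exact hy.ne_empty rfl

/-- A countable subset of the complement of a λ'-set `X` which is closed in this complement
is a Gδ-set. -/
theorem IsLambdaPrimeSet.isGδ_of_isClosed_compl {X S : Set Cantor} (hX : IsLambdaPrimeSet X)
    (hS : S ⊆ Xᶜ) (hcl : IsClosed {p : ↥(Xᶜ) | (p : Cantor) ∈ S}) (hc : S.Countable) :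
    IsGδ S := by
  obtain ⟨G, hG, hSG⟩ := hX S hc
  obtain ⟨C, hC, hCS⟩ := isClosed_induced_iff.mp hcl
  have hmem (x : Cantor) (hx : x ∉ X) : x ∈ C ↔ x ∈ S := Set.ext_iff.mp hCS ⟨x, hx⟩
  have hSC : S = G ∩ C := by
    ext x
    have hxG := Set.ext_iff.mp hSG x
    have hxS := @hS x
    have hxC := hmem x
    simp only [mem_inter_iff, mem_union, mem_compl_iff] at *
    tauto
  rw [hSC]
  exact hG.inter hC.isGδ

/-- If `X ⊆ 2^ω` is a λ'-set, then no subset of `2^ω \ X` which is closed in the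
subspace `2^ω \ X` is homeomorphic to the rationals. -/
theorem no_closed_copy_of_rationals (X : Set Cantor) (hlam : IsLambdaPrimeSet X)
    (S : Set Cantor) (hS : S ⊆ Xᶜ)
    (hcl : IsClosed {p : ↥(Xᶜ) | (p : Cantor) ∈ S}) :
    ¬ Nonempty (↥S ≃ₜ ℚ) := by
  rintro ⟨e⟩
  have hc : S.Countable := Set.countable_coe_iff.mp e.injective.countable
  have := (hlam.isGδ_of_isClosed_compl hS hcl hc).baireSpace_of_t2Space_locallyCompactSpace
  exact not_baireSpace_of_countable e.baireSpace
end

section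
/- If X ⊆ 2^ω is an uncountable saturated λ-set, then for every n ∈ ω the finite power Xⁿ (with the product topology) is countable dense homogeneous. -/
open Set

/-- `X ⊆ 2^ω` is a λ-set if every countable subset of `X` is a relative Gδ-set in `X`. -/
def IsLambdaSet (X : Set Cantor) : Prop :=
  ∀ A : Set Cantor, A ⊆ X → A.Countable → ∃ G : Set Cantor, IsGδ G ∧ A = G ∩ X

section PrefixSwap

open Filter

variable {α : Type*}

open Classical in
/-- Exchange the letters `p i` and `q i` at position `i` as long as the sequence has followed `p`
before `i`. This maps `p` to `q` and changes only finitely many terms of any other sequence. -/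
noncomputable def prefixSwap (p q x : ℕ → α) : ℕ → α :=
  fun i => if ∀ j < i, x j = p j then Equiv.swap (p i) (q i) (x i) else x i

theorem prefixSwap_follows_iff (p q x : ℕ → α) (i : ℕ) :
    (∀ j < i, prefixSwap p q x j = q j) ↔ ∀ j < i, x j = p j := by
  induction i with
  | zero => simp
  | succ i ih =>
    rw [Nat.forall_lt_succ_right, Nat.forall_lt_succ_right, ih]
    refine and_congr_right fun h => ?_
    classical
    rw [prefixSwap, if_pos h, Equiv.swap_apply_eq_iff, Equiv.swap_apply_right]

theorem prefixSwap_prefixSwap (p q x : ℕ → α) : prefixSwap q p (prefixSwap p q x) = x := by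
  classical
  funext i
  by_cases h : ∀ j < i, x j = p j
  · rw [prefixSwap, if_pos ((prefixSwap_follows_iff p q x i).2 h), prefixSwap, if_pos h,
      Equiv.swap_comm, Equiv.swap_apply_self]
  · rw [prefixSwap, if_neg (mt (prefixSwap_follows_iff p q x i).1 h), prefixSwap, if_neg h]

/-- `prefixSwap p q` as a permutation of the sequence space. -/
noncomputable def prefixSwapEquiv (p q : ℕ → α) : (ℕ → α) ≃ (ℕ → α) where
  toFun := prefixSwap p q
  invFun := prefixSwap q p
  left_inv := prefixSwap_prefixSwap p q
  right_inv := prefixSwap_prefixSwap q p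

theorem prefixSwap_self (p q : ℕ → α) : prefixSwap p q p = q := by
  funext i
  simp [prefixSwap]

theorem prefixSwap_agree {p q x y : ℕ → α} {m : ℕ} (h : ∀ i < m, x i = y i) :
    ∀ i < m, prefixSwap p q x i = prefixSwap p q y i := by
  intro i hi
  have : (∀ j < i, x j = p j) ↔ ∀ j < i, y j = p j :=
    forall₂_congr fun j hj => by rw [h j (hj.trans hi)]
  classical
  simp only [prefixSwap, h i hi]
  exact if_congr this rfl rfl

theorem prefixSwap_apply_of_lt {p q : ℕ → α} {m : ℕ} (h : ∀ i < m, p i = q i) (x : ℕ → α) :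
    ∀ i < m, prefixSwap p q x i = x i := by
  intro i hi
  simp [prefixSwap, h i hi]

theorem prefixSwap_of_not_agree {p q x : ℕ → α} {m : ℕ} (h : ∀ i < m, p i = q i)
    (hx : ¬ ∀ i < m, x i = p i) : prefixSwap p q x = x := by
  funext i
  by_cases hi : i < m
  · exact prefixSwap_apply_of_lt h x i hi
  · rw [prefixSwap, if_neg]
    exact fun hj => hx fun k hk => hj k (hk.trans_le (not_lt.1 hi))

theorem prefixSwap_eventuallyEq {p x : ℕ → α} (q : ℕ → α) (h : x ≠ p) :
    prefixSwap p q x =ᶠ[atTop] x := by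
  obtain ⟨k, hk⟩ := Function.ne_iff.1 h
  filter_upwards [eventually_gt_atTop k] with i hi
  rw [prefixSwap, if_neg]
  exact fun hj => hk (hj k hi)

end PrefixSwap

section BackAndForth

open Filter

variable {α : Type*} {A D E F : Set (ℕ → α)} {h h₁ h₂ : (ℕ → α) ≃ (ℕ → α)}
  {P P₁ P₂ : Set (ℕ → α)} {N : ℕ}

/-- A finite approximation to an isometry carrying `D` to `E` and preserving `A`: it matches
the points of the finite set `P` correctly, and is finitary elsewhere. -/
structure IsApprox_s12 (A D E : Set (ℕ → α)) (h : (ℕ → α) ≃ (ℕ → α)) (P : Set (ℕ → α)) : Prop where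
  finite : P.Finite
  agree : ∀ m x y, (∀ i < m, h x i = h y i) ↔ ∀ i < m, x i = y i
  off : ∀ x ∉ P, h x =ᶠ[atTop] x
  mem : ∀ x ∈ P, x ∈ A
  map_mem : ∀ x ∈ P, h x ∈ A
  map_iff : ∀ x ∈ P, (x ∈ D ↔ h x ∈ E)

/-- The approximation `(h₁, P₁)` refines `(h, P)` without changing the values on `P` and `F`, nor
the inverse values on `F`, nor the first `N` terms of any value. -/
structure Refines_s12 (F : Set (ℕ → α)) (N : ℕ) (h : (ℕ → α) ≃ (ℕ → α)) (P : Set (ℕ → α))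
    (h₁ : (ℕ → α) ≃ (ℕ → α)) (P₁ : Set (ℕ → α)) : Prop where
  subset : P ⊆ P₁
  eq_on : ∀ x ∈ P, h₁ x = h x
  eq_frozen : ∀ x ∈ F, h₁ x = h x
  symm_eq_frozen : ∀ x ∈ F, h₁.symm x = h.symm x
  agree : ∀ x, ∀ i < N, h₁ x i = h x i

theorem IsApprox_s12.refl (A D E : Set (ℕ → α)) : IsApprox_s12 A D E (Equiv.refl _) ∅ where
  finite := Set.finite_empty
  agree _ _ _ := Iff.rfl
  off _ _ := EventuallyEq.rfl
  mem _ hx := hx.elim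
  map_mem _ hx := hx.elim
  map_iff _ hx := hx.elim

theorem IsApprox_s12.symm (H : IsApprox_s12 A D E h P) : IsApprox_s12 A E D h.symm (h '' P) where
  finite := H.finite.image h
  agree m x y := by simpa using (H.agree m (h.symm x) (h.symm y)).symm
  off x hx := by
    have := H.off (h.symm x) fun hP => hx ⟨_, hP, h.apply_symm_apply x⟩
    rw [h.apply_symm_apply] at this
    exact this.symm
  mem := by
    rintro _ ⟨x, hx, rfl⟩
    exact H.map_mem x hx
  map_mem := by
    rintro _ ⟨x, hx, rfl⟩
    simpa using H.mem x hx
  map_iff := by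
    rintro _ ⟨x, hx, rfl⟩
    simpa using (H.map_iff x hx).symm

theorem IsApprox_s12.apply_mem (H : IsApprox_s12 A D E h P)
    (hA : ∀ x ∈ A, ∀ y, y =ᶠ[atTop] x → y ∈ A) {x : ℕ → α} (hx : x ∈ A) : h x ∈ A := by
  by_cases hP : x ∈ P
  · exact H.map_mem x hP
  · exact hA x hx _ (H.off x hP)

theorem Refines_s12.refl (F : Set (ℕ → α)) (N : ℕ) (h : (ℕ → α) ≃ (ℕ → α)) (P : Set (ℕ → α)) :
    Refines_s12 F N h P h P where
  subset := subset_rfl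
  eq_on _ _ := rfl
  eq_frozen _ _ := rfl
  symm_eq_frozen _ _ := rfl
  agree _ _ _ := rfl

theorem Refines_s12.trans (H₁ : Refines_s12 F N h P h₁ P₁) (H₂ : Refines_s12 F N h₁ P₁ h₂ P₂) :
    Refines_s12 F N h P h₂ P₂ where
  subset := H₁.subset.trans H₂.subset
  eq_on x hx := (H₂.eq_on x (H₁.subset hx)).trans (H₁.eq_on x hx)
  eq_frozen x hx := (H₂.eq_frozen x hx).trans (H₁.eq_frozen x hx)
  symm_eq_frozen x hx := (H₂.symm_eq_frozen x hx).trans (H₁.symm_eq_frozen x hx)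
  agree x i hi := (H₂.agree x i hi).trans (H₁.agree x i hi)

theorem Refines_s12.symm (H : Refines_s12 F N h P h₁ P₁) (H₁ : IsApprox_s12 A D E h₁ P₁) :
    Refines_s12 F N h.symm (h '' P) h₁.symm (h₁ '' P₁) where
  subset := by
    rintro _ ⟨x, hx, rfl⟩
    exact ⟨x, H.subset hx, H.eq_on x hx⟩
  eq_on := by
    rintro _ ⟨x, hx, rfl⟩
    rw [← H.eq_on x hx, h₁.symm_apply_apply, H.eq_on x hx, h.symm_apply_apply]
  eq_frozen := H.symm_eq_frozen
  symm_eq_frozen := H.eq_frozen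
  agree x := by
    rw [← H₁.agree, h₁.apply_symm_apply]
    intro i hi
    rw [H.agree _ i hi, h.apply_symm_apply]

/-- A new pair `p ↦ q` can be added when `h p` and `q` share a cone missing all frozen points. -/
theorem IsApprox_s12.exists_insert (H : IsApprox_s12 A D E h P) {p q : ℕ → α} (hp : p ∈ A) (hq : q ∈ A)
    (hpq : p ∈ D ↔ q ∈ E) {m : ℕ} (hm : N ≤ m) (hagree : ∀ i < m, h p i = q i)
    (hP : ∀ x ∈ P, ¬ ∀ i < m, x i = p i) (hF : ∀ x ∈ F, ¬ ∀ i < m, x i = p i)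
    (hF' : ∀ x ∈ F, ¬ ∀ i < m, x i = h p i) :
    ∃ h₁ P₁, IsApprox_s12 A D E h₁ P₁ ∧ Refines_s12 F N h P h₁ P₁ ∧ p ∈ P₁ := by
  have hP' : ∀ x, (¬ ∀ i < m, x i = p i) → prefixSwap (h p) q (h x) = h x := fun x hx =>
    prefixSwap_of_not_agree hagree (by rwa [H.agree])
  have hpP : ∀ x ∈ P, x ≠ p := by
    rintro x hx rfl
    exact hP x hx fun _ _ => rfl
  refine ⟨h.trans (prefixSwapEquiv (h p) q), insert p P, ⟨H.finite.insert p, ?_, ?_, ?_, ?_, ?_⟩,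
    ⟨Set.subset_insert p P, ?_, ?_, ?_, ?_⟩, Set.mem_insert p P⟩
  · intro m x y
    rw [← H.agree m x y]
    refine ⟨fun hxy => ?_, prefixSwap_agree⟩
    have := prefixSwap_agree (p := q) (q := h p) hxy
    simpa only [Equiv.trans_apply, prefixSwapEquiv, Equiv.coe_fn_mk, prefixSwap_prefixSwap]
      using this
  · intro x hx
    rw [Set.mem_insert_iff, not_or] at hx
    exact (prefixSwap_eventuallyEq q (h.injective.ne hx.1)).trans (H.off x hx.2)
  · rintro x (rfl | hx)
    exacts [hp, H.mem x hx]
  · rintro x (rfl | hx)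
    · simpa [prefixSwapEquiv, prefixSwap_self] using hq
    · simpa [prefixSwapEquiv, hP' x (hP x hx)] using H.map_mem x hx
  · rintro x (rfl | hx)
    · simpa [prefixSwapEquiv, prefixSwap_self] using hpq
    · simpa [prefixSwapEquiv, hP' x (hP x hx)] using H.map_iff x hx
  · exact fun x hx => hP' x (hP x hx)
  · exact fun x hx => hP' x (hF x hx)
  · intro x hx
    have : prefixSwap q (h p) x = x := by
      refine prefixSwap_of_not_agree (fun i hi => (hagree i hi).symm) fun hxq => ?_
      exact hF' x hx fun i hi => (hxq i hi).trans (hagree i hi).symm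
    simp [prefixSwapEquiv, this]
  · intro x i hi
    exact prefixSwap_apply_of_lt hagree (h x) i (hi.trans_le hm)

theorem exists_agree_avoids [TopologicalSpace α] [DiscreteTopology α] (hF : IsClosed F)
    {p : ℕ → α} (hp : p ∉ F) : ∃ m, ∀ k ≥ m, ∀ x ∈ F, ¬ ∀ i < k, x i = p i := by
  obtain ⟨_, ⟨y, m, rfl⟩, hpy, hy⟩ :=
    (PiNat.isTopologicalBasis_cylinders fun _ : ℕ => α).exists_subset_of_mem_open
      (show p ∈ Fᶜ from hp) hF.isOpen_compl
  refine ⟨m, fun k hk x hx hxp => hy (show x ∈ PiNat.cylinder y m from ?_) hx⟩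
  exact fun i hi => (hxp i (hi.trans_le hk)).trans (hpy i hi)

theorem IsApprox_s12.exists_forth [TopologicalSpace α] [DiscreteTopology α]
    (H : IsApprox_s12 A D E h P) (hA : ∀ x ∈ A, ∀ y, y =ᶠ[atTop] x → y ∈ A) (hF : IsClosed F)
    (hFA : Disjoint F A) (hE : ∀ x ∈ A, ∀ m : ℕ, ∃ y ∈ A, y ∈ E ∧ ∀ i < m, x i = y i)
    (hE' : ∀ x ∈ A, ∀ m : ℕ, ∃ y ∈ A, y ∉ E ∧ ∀ i < m, x i = y i) (N : ℕ)
    {p : ℕ → α} (hp : p ∈ A) :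
    ∃ h₁ P₁, IsApprox_s12 A D E h₁ P₁ ∧ Refines_s12 F N h P h₁ P₁ ∧ p ∈ P₁ := by
  by_cases hpP : p ∈ P
  · exact ⟨h, P, H, Refines_s12.refl F N h P, hpP⟩
  have hhp := H.apply_mem hA hp
  obtain ⟨a, ha⟩ := exists_agree_avoids H.finite.isClosed hpP
  obtain ⟨b, hb⟩ := exists_agree_avoids hF (hFA.notMem_of_mem_right hp)
  obtain ⟨c, hc⟩ := exists_agree_avoids hF (hFA.notMem_of_mem_right hhp)
  set m := N + a + b + c
  have hq : ∃ q ∈ A, (p ∈ D ↔ q ∈ E) ∧ ∀ i < m, h p i = q i := by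
    by_cases hpD : p ∈ D
    · simpa only [hpD, true_iff] using hE (h p) hhp m
    · simpa only [hpD, false_iff] using hE' (h p) hhp m
  obtain ⟨q, hqA, hpq, hagree⟩ := hq
  exact H.exists_insert hp hqA hpq (by omega : N ≤ m) hagree (ha m (by omega)) (hb m (by omega))
    (hc m (by omega))

theorem IsApprox_s12.exists_back_and_forth [TopologicalSpace α] [DiscreteTopology α]
    (H : IsApprox_s12 A D E h P) (hA : ∀ x ∈ A, ∀ y, y =ᶠ[atTop] x → y ∈ A) (hF : IsClosed F)
    (hFA : Disjoint F A) (hD : ∀ x ∈ A, ∀ m : ℕ, ∃ y ∈ A, y ∈ D ∧ ∀ i < m, x i = y i)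
    (hD' : ∀ x ∈ A, ∀ m : ℕ, ∃ y ∈ A, y ∉ D ∧ ∀ i < m, x i = y i)
    (hE : ∀ x ∈ A, ∀ m : ℕ, ∃ y ∈ A, y ∈ E ∧ ∀ i < m, x i = y i)
    (hE' : ∀ x ∈ A, ∀ m : ℕ, ∃ y ∈ A, y ∉ E ∧ ∀ i < m, x i = y i) (N : ℕ)
    {p : ℕ → α} (hp : p ∈ A) :
    ∃ h₁ P₁, IsApprox_s12 A D E h₁ P₁ ∧ Refines_s12 F N h P h₁ P₁ ∧ p ∈ P₁ ∧ p ∈ h₁ '' P₁ := by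
  obtain ⟨h₁, P₁, H₁, R₁, hp₁⟩ := H.exists_forth hA hF hFA hE hE' N hp
  obtain ⟨h₂, P₂, H₂, R₂, hp₂⟩ := H₁.symm.exists_forth hA hF hFA hD hD' N hp
  have R₂' := R₂.symm H₂
  rw [Equiv.symm_symm, Equiv.symm_image_image] at R₂'
  refine ⟨h₂.symm, h₂ '' P₂, H₂.symm, R₁.trans R₂', R₂'.subset hp₁, ?_⟩
  rwa [Equiv.symm_image_image]

theorem Refines_s12.of_le {h : ℕ → (ℕ → α) ≃ (ℕ → α)} {P F : ℕ → Set (ℕ → α)} (hF : Monotone F)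
    (R : ∀ k, Refines_s12 (F k) k (h k) (P k) (h (k + 1)) (P (k + 1))) {k l : ℕ} (hkl : k ≤ l) :
    Refines_s12 (F k) k (h k) (P k) (h l) (P l) := by
  induction l, hkl using Nat.le_induction with
  | base => exact Refines_s12.refl _ _ _ _
  | succ l hkl ih =>
    refine ih.trans ⟨(R l).subset, (R l).eq_on, fun x hx => (R l).eq_frozen x (hF hkl hx),
      fun x hx => (R l).symm_eq_frozen x (hF hkl hx), fun x i hi => ?_⟩
    exact (R l).agree x i (hi.trans_le hkl)

/-- The coordinatewise limit of a sequence of maps whose `n`-th term is eventually constant. -/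
def diagonalLimit (h : ℕ → (ℕ → α) → ℕ → α) (x : ℕ → α) : ℕ → α := fun i => h (i + 1) x i

theorem diagonalLimit_apply {h : ℕ → (ℕ → α) → ℕ → α}
    (hh : ∀ k l, k ≤ l → ∀ x, ∀ i < k, h l x i = h k x i) (k : ℕ) (x : ℕ → α) :
    ∀ i < k, diagonalLimit h x i = h k x i :=
  fun i hi => (hh (i + 1) k hi x i (Nat.lt_succ_self i)).symm

theorem diagonalLimit_eq {h : ℕ → (ℕ → α) → ℕ → α}
    (hh : ∀ k l, k ≤ l → ∀ x, ∀ i < k, h l x i = h k x i) {k : ℕ} {x : ℕ → α}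
    (hx : ∀ l ≥ k, h l x = h k x) : diagonalLimit h x = h k x := by
  funext i
  rw [diagonalLimit_apply hh (max k (i + 1)) x i (by omega), hx _ (le_max_left _ _)]

theorem diagonalLimit_leftInverse {h g : ℕ → (ℕ → α) → ℕ → α}
    (hh : ∀ k l, k ≤ l → ∀ x, ∀ i < k, h l x i = h k x i)
    (hg : ∀ k l, k ≤ l → ∀ x, ∀ i < k, g l x i = g k x i)
    (hga : ∀ k m x y, (∀ i < m, x i = y i) → ∀ i < m, g k x i = g k y i)
    (hgh : ∀ k x, g k (h k x) = x) (x : ℕ → α) :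
    diagonalLimit g (diagonalLimit h x) = x := by
  funext i
  rw [diagonalLimit_apply hg (i + 1) _ i i.lt_succ_self,
    hga (i + 1) (i + 1) _ _ (diagonalLimit_apply hh (i + 1) x) i i.lt_succ_self, hgh]

theorem continuous_of_agree [TopologicalSpace α] [DiscreteTopology α] {f : (ℕ → α) → ℕ → α}
    (hf : ∀ m x y, (∀ i < m, x i = y i) → ∀ i < m, f x i = f y i) : Continuous f := by
  refine continuous_pi fun i => IsLocallyConstant.continuous ?_
  rw [IsLocallyConstant.iff_exists_open]
  refine fun x => ⟨PiNat.cylinder x (i + 1), PiNat.isOpen_cylinder _ x _,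
    PiNat.self_mem_cylinder x _, fun y hy => ?_⟩
  exact hf (i + 1) y x hy i i.lt_succ_self

theorem diagonalLimit_continuous [TopologicalSpace α] [DiscreteTopology α]
    {h : ℕ → (ℕ → α) → ℕ → α} (hh : ∀ k l, k ≤ l → ∀ x, ∀ i < k, h l x i = h k x i)
    (hha : ∀ k m x y, (∀ i < m, x i = y i) → ∀ i < m, h k x i = h k y i) :
    Continuous (diagonalLimit h) := by
  refine continuous_of_agree fun m x y hxy i hi => ?_
  rw [diagonalLimit_apply hh m x i hi, diagonalLimit_apply hh m y i hi]
  exact hha m m x y hxy i hi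

theorem diagonalLimit_mapsTo {Y : Set (ℕ → α)} {h : ℕ → (ℕ → α) ≃ (ℕ → α)}
    {P F : ℕ → Set (ℕ → α)} (hAY : A ⊆ Y) (hY : ∀ x ∈ Y, ∀ y, y =ᶠ[atTop] x → y ∈ Y)
    (hFY : Y \ A ⊆ ⋃ k, F k)
    (H : ∀ k, IsApprox_s12 A D E (h k) (P k))
    (R : ∀ k l, k ≤ l → Refines_s12 (F k) k (h k) (P k) (h l) (P l))
    (hP : ∀ x ∈ A, ∃ k, x ∈ P k) {x : ℕ → α} (hx : x ∈ Y) :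
    diagonalLimit (fun k => h k) x ∈ Y ∧
      (x ∈ A → x ∈ D → diagonalLimit (fun k => h k) x ∈ E) := by
  have hlim := fun k l hkl => (R k l hkl).agree
  by_cases hxA : x ∈ A
  · obtain ⟨k, hk⟩ := hP x hxA
    rw [diagonalLimit_eq (k := k) hlim fun l hl => (R k l hl).eq_on x hk]
    exact ⟨hAY ((H k).map_mem x hk), fun _ => ((H k).map_iff x hk).1⟩
  · obtain ⟨k, hk⟩ := Set.mem_iUnion.1 (hFY ⟨hx, hxA⟩)
    rw [diagonalLimit_eq (k := k) hlim fun l hl => (R k l hl).eq_frozen x hk]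
    exact ⟨hY x hx _ ((H k).off x fun hP => hxA ((H k).mem x hP)), fun h => (hxA h).elim⟩

theorem exists_homeomorph_of_frozen [TopologicalSpace α] [DiscreteTopology α]
    {Y : Set (ℕ → α)} {F : ℕ → Set (ℕ → α)} (hAc : A.Countable) (hAne : A.Nonempty)
    (hAY : A ⊆ Y) (hY : ∀ x ∈ Y, ∀ y, y =ᶠ[atTop] x → y ∈ Y)
    (hA : ∀ x ∈ A, ∀ y, y =ᶠ[atTop] x → y ∈ A) (hF : Monotone F) (hFc : ∀ k, IsClosed (F k))
    (hFA : ∀ k, Disjoint (F k) A) (hFY : Y \ A ⊆ ⋃ k, F k)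
    (hD : ∀ x ∈ A, ∀ m : ℕ, ∃ y ∈ A, y ∈ D ∧ ∀ i < m, x i = y i)
    (hD' : ∀ x ∈ A, ∀ m : ℕ, ∃ y ∈ A, y ∉ D ∧ ∀ i < m, x i = y i)
    (hE : ∀ x ∈ A, ∀ m : ℕ, ∃ y ∈ A, y ∈ E ∧ ∀ i < m, x i = y i)
    (hE' : ∀ x ∈ A, ∀ m : ℕ, ∃ y ∈ A, y ∉ E ∧ ∀ i < m, x i = y i) :
    ∃ f : (ℕ → α) ≃ₜ (ℕ → α), (∀ x ∈ Y, f x ∈ Y ∧ (x ∈ A → x ∈ D → f x ∈ E)) ∧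
      ∀ x ∈ Y, f.symm x ∈ Y ∧ (x ∈ A → x ∈ E → f.symm x ∈ D) := by
  obtain ⟨a, ha⟩ := hAc.exists_eq_range hAne
  have haA : ∀ k, a k ∈ A := fun k => ha ▸ Set.mem_range_self k
  choose! s S hs using fun (k : ℕ) (h : (ℕ → α) ≃ (ℕ → α)) (P : Set (ℕ → α))
    (H : IsApprox_s12 A D E h P) => H.exists_back_and_forth hA (hFc k) (hFA k) hD hD' hE hE' k (haA k)
  let u : ℕ → ((ℕ → α) ≃ (ℕ → α)) × Set (ℕ → α) := fun k =>
    Nat.rec (Equiv.refl _, ∅) (fun k v => (s k v.1 v.2, S k v.1 v.2)) k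
  have H : ∀ k, IsApprox_s12 A D E (u k).1 (u k).2 := by
    intro k
    induction k with
    | zero => exact IsApprox_s12.refl A D E
    | succ k ih => exact (hs k _ _ ih).1
  have R : ∀ k l, k ≤ l → Refines_s12 (F k) k (u k).1 (u k).2 (u l).1 (u l).2 := fun k l =>
    Refines_s12.of_le (h := fun k => (u k).1) (P := fun k => (u k).2) hF
      fun k => (hs k _ _ (H k)).2.1
  have R' := fun k l hkl => (R k l hkl).symm (H l)
  have hP : ∀ x ∈ A, ∃ k, x ∈ (u k).2 := by
    rw [ha]
    rintro _ ⟨k, rfl⟩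
    exact ⟨k + 1, (hs k _ _ (H k)).2.2.1⟩
  have hP' : ∀ x ∈ A, ∃ k, x ∈ (u k).1 '' (u k).2 := by
    rw [ha]
    rintro _ ⟨k, rfl⟩
    exact ⟨k + 1, (hs k _ _ (H k)).2.2.2⟩
  have hlim := fun k l hkl => (R k l hkl).agree
  have hlim' := fun k l hkl => (R' k l hkl).agree
  have hag := fun k m x y => ((H k).agree m x y).2
  have hag' := fun k m x y => ((H k).symm.agree m x y).2
  let f : (ℕ → α) ≃ₜ (ℕ → α) :=
    { toFun := diagonalLimit fun k => (u k).1
      invFun := diagonalLimit fun k => (u k).1.symm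
      left_inv := diagonalLimit_leftInverse hlim hlim' hag' fun k => (u k).1.symm_apply_apply
      right_inv := diagonalLimit_leftInverse hlim' hlim hag fun k => (u k).1.apply_symm_apply
      continuous_toFun := diagonalLimit_continuous hlim hag
      continuous_invFun := diagonalLimit_continuous hlim' hag' }
  exact ⟨f, fun x => diagonalLimit_mapsTo hAY hY hFY H R hP,
    fun x => diagonalLimit_mapsTo hAY hY hFY (fun k => (H k).symm) R' hP'⟩

/-- The sequences that eventually agree with a member of `B`. -/
def finitaryClosure (B : Set (ℕ → α)) : Set (ℕ → α) := {y | ∃ x ∈ B, y =ᶠ[atTop] x}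

theorem countable_finitaryClosure [Countable α] {B : Set (ℕ → α)} (hB : B.Countable) :
    (finitaryClosure B).Countable := by
  have : finitaryClosure B ⊆ ⋃ x ∈ B, Set.range fun l : List α =>
      fun i => l.getD i (x i) := by
    rintro y ⟨x, hx, hyx⟩
    obtain ⟨m, hm⟩ := eventually_atTop.1 hyx
    refine Set.mem_biUnion hx ⟨List.ofFn fun i : Fin m => y i, ?_⟩
    funext i
    by_cases hi : i < m
    · simp [List.getD, hi]
    · simp [List.getD, hi, hm i (not_lt.1 hi)]
  exact (hB.biUnion fun x _ => Set.countable_range _).mono this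

theorem exists_eventuallyEq_agree (x y : ℕ → α) (m : ℕ) :
    ∃ z, z =ᶠ[atTop] y ∧ ∀ i < m, x i = z i := by
  refine ⟨fun i => if i < m then x i else y i, ?_, fun i hi => by simp [hi]⟩
  filter_upwards [eventually_ge_atTop m] with i hi
  simp [not_lt.2 hi]

end BackAndForth

open Filter in
/-- An uncountable set of sequences closed under finite modification, all of whose countable
subsets are relatively `Gδ`, is CDH. -/
theorem isCDH_of_finitary_lambda {α : Type*} [Countable α] [TopologicalSpace α]
    [DiscreteTopology α] {Y : Set (ℕ → α)} (hunc : ¬ Y.Countable)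
    (hY : ∀ x ∈ Y, ∀ y, y =ᶠ[atTop] x → y ∈ Y)
    (hlam : ∀ A ⊆ Y, A.Countable → ∃ G, IsGδ G ∧ A = G ∩ Y) : IsCDH Y := by
  intro D E hDc hDd hEc hEd
  set D₁ : Set (ℕ → α) := Subtype.val '' D
  set E₁ : Set (ℕ → α) := Subtype.val '' E
  have hBc : (D₁ ∪ E₁).Countable := (hDc.image _).union (hEc.image _)
  have hBY : D₁ ∪ E₁ ⊆ Y := by simp [D₁, E₁]
  obtain ⟨y₀, hy₀Y, hy₀⟩ : ∃ y ∈ Y, y ∉ finitaryClosure (D₁ ∪ E₁) := by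
    by_contra! hcon
    exact hunc ((countable_finitaryClosure hBc).mono hcon)
  set A := finitaryClosure (insert y₀ (D₁ ∪ E₁))
  have hBA : insert y₀ (D₁ ∪ E₁) ⊆ A := fun x hx => ⟨x, hx, EventuallyEq.rfl⟩
  have hAY : A ⊆ Y := by
    rintro y ⟨x, hx, hyx⟩
    exact hY x (Set.insert_subset hy₀Y hBY hx) y hyx
  have hA : ∀ x ∈ A, ∀ y, y =ᶠ[atTop] x → y ∈ A := by
    rintro x ⟨z, hz, hxz⟩ y hyx
    exact ⟨z, hz, hyx.trans hxz⟩
  have hAc : A.Countable := countable_finitaryClosure (hBc.insert y₀)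
  obtain ⟨G, hG, hAG⟩ := hlam A hAY hAc
  obtain ⟨U, hU, rfl⟩ := isGδ_iff_eq_iInter_nat.1 hG
  have hdense : ∀ C : Set Y, Dense C → Subtype.val '' C ⊆ A → ∀ x ∈ A, ∀ m : ℕ,
      ∃ y ∈ A, y ∈ Subtype.val '' C ∧ ∀ i < m, x i = y i := by
    intro C hC hCA x hx m
    obtain ⟨y, hy, hyC⟩ := hC.inter_open_nonempty _
      ((PiNat.isOpen_cylinder (fun _ : ℕ => α) x m).preimage continuous_subtype_val)
      ⟨⟨x, hAY hx⟩, PiNat.self_mem_cylinder x m⟩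
    exact ⟨y, hCA ⟨y, hyC, rfl⟩, ⟨y, hyC, rfl⟩, fun i hi => (hy i hi).symm⟩
  have hcodense : ∀ C ⊆ D₁ ∪ E₁, ∀ x ∈ A, ∀ m : ℕ, ∃ y ∈ A, y ∉ C ∧ ∀ i < m, x i = y i := by
    intro C hC x _ m
    obtain ⟨z, hz, hxz⟩ := exists_eventuallyEq_agree x y₀ m
    exact ⟨z, ⟨y₀, Set.mem_insert _ _, hz⟩, fun hzC => hy₀ ⟨z, hC hzC, hz.symm⟩, hxz⟩
  have hDA : D₁ ⊆ A := (Set.subset_union_left.trans (Set.subset_insert _ _)).trans hBA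
  have hEA : E₁ ⊆ A := (Set.subset_union_right.trans (Set.subset_insert _ _)).trans hBA
  obtain ⟨f, hf, hf'⟩ := exists_homeomorph_of_frozen (D := D₁) (E := E₁)
    (F := Set.accumulate fun k => (U k)ᶜ) hAc
    ⟨y₀, hBA (Set.mem_insert _ _)⟩ hAY hY hA Set.monotone_accumulate
    (fun k => (Set.finite_le_nat k).isClosed_biUnion fun i _ => (hU i).isClosed_compl)
    (by
      intro k
      rw [Set.disjoint_left]
      intro x hx hxA
      obtain ⟨i, -, hi⟩ := Set.mem_accumulate.1 hx
      exact hi (Set.mem_iInter.1 (hAG ▸ hxA).1 i))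
    (by
      rintro x ⟨hxY, hxA⟩
      rw [Set.iUnion_accumulate, ← Set.compl_iInter]
      exact fun hx => hxA (hAG ▸ ⟨hx, hxY⟩))
    (hdense D hDd hDA) (hcodense D₁ Set.subset_union_left) (hdense E hEd hEA)
    (hcodense E₁ Set.subset_union_right)
  refine ⟨f.subtype fun x => ⟨fun hx => (hf x hx).1, fun hx => ?_⟩, ?_⟩
  · simpa using (hf' (f x) hx).1
  · ext y
    constructor
    · rintro ⟨x, hx, rfl⟩
      have hxD : (x : ℕ → α) ∈ D₁ := ⟨x, hx, rfl⟩
      obtain ⟨z, hz, hzx⟩ := (hf x x.2).2 (hDA hxD) hxD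
      convert hz
      exact Subtype.ext hzx.symm
    · intro hy
      have hyE : (y : ℕ → α) ∈ E₁ := ⟨y, hy, rfl⟩
      obtain ⟨z, hz, hzy⟩ := (hf' y y.2).2 (hEA hyE) hyE
      refine ⟨z, hz, Subtype.ext ?_⟩
      change f z = y
      rw [hzy, f.apply_symm_apply]

theorem IsCDH.of_homeomorph {X Y : Type*} [TopologicalSpace X] [TopologicalSpace Y]
    (hY : IsCDH Y) (e : X ≃ₜ Y) : IsCDH X := by
  intro D E hDc hDd hEc hEd
  obtain ⟨f, hf⟩ := hY (e '' D) (e '' E) (hDc.image e)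
    (e.surjective.denseRange.dense_image e.continuous hDd)
    (hEc.image e) (e.surjective.denseRange.dense_image e.continuous hEd)
  refine ⟨(e.trans f).trans e.symm, ?_⟩
  have : ((e.trans f).trans e.symm : X → X) = e.symm ∘ f ∘ e := rfl
  rw [this, Set.image_comp, Set.image_comp, hf, ← Set.image_comp]
  simp

theorem IsCDH.of_subsingleton (X : Type*) [TopologicalSpace X] [Subsingleton X] : IsCDH X := by
  intro D E _ hD _ hE
  refine ⟨Homeomorph.refl X, ?_⟩
  have key : ∀ C : Set X, Dense C → C = Set.univ := fun C hC =>
    Set.eq_univ_of_forall fun x => by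
      obtain ⟨y, hy⟩ := hC.nonempty_iff.2 ⟨x⟩
      rwa [Subsingleton.elim x y]
  rw [key D hD, key E hE]
  simp

/-- The power `X ^ ι`, viewed as a set of sequences of letters `ι → Bool`. -/
def interleaved (ι : Type*) (X : Set Cantor) : Set (ℕ → ι → Bool) :=
  {z | ∀ i, (fun k => z k i) ∈ X}

/-- The homeomorphism between a power of `X` and the interleaved set of sequences. -/
def interleavedHomeomorph (ι : Type*) (X : Set Cantor) : (ι → X) ≃ₜ interleaved ι X where
  toFun x := ⟨fun k i => (x i : Cantor) k, fun i => (x i).2⟩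
  invFun z i := ⟨fun k => z.1 k i, z.2 i⟩
  left_inv _ := rfl
  right_inv _ := rfl
  continuous_toFun := Continuous.subtype_mk (continuous_pi fun k => continuous_pi fun i =>
    (continuous_apply k).comp (continuous_subtype_val.comp
      (continuous_apply (A := fun _ : ι => X) i))) _
  continuous_invFun := continuous_pi fun i => Continuous.subtype_mk (continuous_pi fun k =>
    (continuous_apply i).comp ((continuous_apply k).comp continuous_subtype_val)) _

theorem not_countable_interleaved (ι : Type*) [Nonempty ι] {X : Set Cantor}
    (hX : ¬ X.Countable) : ¬ (interleaved ι X).Countable := by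
  intro h
  have : Countable (interleaved ι X) := h
  let g : X → interleaved ι X := fun x => ⟨fun k _ => (x : Cantor) k, fun _ => x.2⟩
  have hg : Function.Injective g := by
    intro x y hxy
    ext k
    exact congrFun (congrFun (congrArg Subtype.val hxy) k) (Classical.arbitrary ι)
  exact hX hg.countable

open Filter in
theorem interleaved_of_eventuallyEq {ι : Type*} {X : Set Cantor} (hsat : Saturated X)
    {x y : ℕ → ι → Bool} (hx : x ∈ interleaved ι X) (hyx : y =ᶠ[atTop] x) :
    y ∈ interleaved ι X := by
  obtain ⟨m, hm⟩ := eventually_atTop.1 hyx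
  intro i
  rw [hsat]
  exact ⟨_, hx i, m, m, fun k => congrFun (hm (m + k) (Nat.le_add_right m k)) i⟩

theorem interleaved_lambda {ι : Type*} [Finite ι] {X : Set Cantor} (hlam : IsLambdaSet X)
    (A : Set (ℕ → ι → Bool)) (hA : A ⊆ interleaved ι X) (hAc : A.Countable) :
    ∃ G, IsGδ G ∧ A = G ∩ interleaved ι X := by
  have hex := fun i => hlam ((fun z k => z k i) '' A)
    (by rintro _ ⟨z, hz, rfl⟩; exact hA hz i) (hAc.image _)
  choose G hG hAG using hex
  set C : Set (ℕ → ι → Bool) := {z | ∀ i, (fun k => z k i) ∈ (fun z k => z k i) '' A}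
  have hC : C.Countable := by
    have hpi := Set.countable_univ_pi fun i => hAc.image fun z : ℕ → ι → Bool => fun k => z k i
    refine (hpi.preimage_of_injOn (f := fun (z : ℕ → ι → Bool) i k => z k i) ?_).mono ?_
    · intro x _ y _ hxy
      funext k i
      exact congrFun (congrFun hxy i) k
    · exact fun z hz i _ => hz i
  refine ⟨(⋂ i, (fun z k => z k i) ⁻¹' G i) ∩ (C \ A)ᶜ,
    (IsGδ.iInter fun i => (hG i).preimage (by fun_prop)).inter
      (hC.mono Set.sdiff_subset).isGδ_compl, ?_⟩
  ext z
  constructor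
  · intro hz
    refine ⟨⟨Set.mem_iInter.2 fun i => ?_, fun h => h.2 hz⟩, hA hz⟩
    exact ((hAG i).subset ⟨z, hz, rfl⟩).1
  · rintro ⟨⟨hzG, hzC⟩, hzX⟩
    by_contra hzA
    exact hzC ⟨fun i => (hAG i).superset ⟨Set.mem_iInter.1 hzG i, hzX i⟩, hzA⟩

/-- Every finite power of an uncountable saturated λ-set is CDH. -/
theorem finite_powers_CDH_of_saturated_lambda (X : Set Cantor)
    (hunc : ¬ X.Countable) (hsat : Saturated X) (hlam : IsLambdaSet X) :
    ∀ n : ℕ, IsCDH (Fin n → ↥X) := by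
  intro n
  rcases n.eq_zero_or_pos with rfl | hn
  · exact IsCDH.of_subsingleton _
  · have : Nonempty (Fin n) := ⟨⟨0, hn⟩⟩
    exact (isCDH_of_finitary_lambda (not_countable_interleaved (Fin n) hunc)
      (fun x hx y => interleaved_of_eventuallyEq hsat hx)
      (interleaved_lambda hlam)).of_homeomorph (interleavedHomeomorph (Fin n) X)
end

section
/- If X ⊆ 2^ω is an uncountable saturated λ-set, then the countable power X^ω (with the product topology) is not countable dense homogeneous. -/
open Set

open Filter Topology

theorem tendsto_update_not (x : Cantor) :
    Tendsto (fun n => Function.update x n (!x n)) atTop (𝓝 x) := by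
  rw [tendsto_pi_nhds]
  intro i
  refine tendsto_const_nhds.congr' ?_
  filter_upwards [eventually_gt_atTop i] with n hn
  rw [Function.update_of_ne hn.ne]

theorem update_not_ne (x : Cantor) (n : ℕ) : Function.update x n (!x n) ≠ x := by
  intro h
  simpa using congrFun h n

theorem Cantor.nhdsNE_neBot (x : Cantor) : NeBot (𝓝[≠] x) :=
  (tendsto_nhdsWithin_iff.2
    ⟨tendsto_update_not x, Eventually.of_forall (update_not_ne x)⟩).neBot

theorem Saturated.update_mem {X : Set Cantor} (hX : Saturated X) {x : Cantor} (hx : x ∈ X)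
    (n : ℕ) (b : Bool) : Function.update x n b ∈ X := by
  rw [hX]
  refine ⟨x, hx, n + 1, n + 1, fun k => ?_⟩
  rw [Function.update_of_ne (by omega)]

theorem Saturated.nhdsNE_neBot {X : Set Cantor} (hX : Saturated X) (x : X) :
    NeBot (𝓝[≠] x) := by
  have h : Tendsto (fun n => (⟨_, hX.update_mem x.2 n (!x.1 n)⟩ : X)) atTop (𝓝 x) :=
    tendsto_subtype_rng.2 (tendsto_update_not x.1)
  refine (tendsto_nhdsWithin_iff.2 ⟨h, Eventually.of_forall fun n => ?_⟩).neBot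
  exact fun hn => update_not_ne x.1 n (congrArg Subtype.val hn)

/-- A space without isolated points having a countable dense `Gδ` subset is meagre in itself. -/
theorem empty_mem_residual_of_countable_dense_isGδ {Y : Type*} [TopologicalSpace Y] [T1Space Y]
    (hY : ∀ y : Y, NeBot (𝓝[≠] y)) {D : Set Y} (hc : D.Countable) (hd : Dense D) (hG : IsGδ D) :
    ∅ ∈ residual Y := by
  have hcompl : Dᶜ ∈ residual Y := by
    rw [← biUnion_of_singleton D, compl_iUnion₂]
    refine (countable_bInter_mem hc).2 fun y _ => ?_
    have := hY y
    exact residual_of_dense_open isOpen_compl_singleton (dense_compl_singleton y)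
  simpa using inter_mem (residual_of_dense_Gδ hG hd) hcompl

/-- A nonempty second countable T₁ space which is meagre in itself has a countable dense `Gδ`
subset. -/
theorem exists_countable_dense_isGδ {Z : Type*} [TopologicalSpace Z] [SecondCountableTopology Z]
    [T1Space Z] [Nonempty Z] (h : ∅ ∈ residual Z) :
    ∃ D : Set Z, D.Countable ∧ Dense D ∧ IsGδ D := by
  obtain ⟨S, hSo, hSd, hSc, hS⟩ := mem_residual_iff.1 h
  have hne : (insert univ S).Nonempty := insert_nonempty _ _
  obtain ⟨V, hV⟩ := (hSc.insert univ).exists_eq_range hne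
  have hVod : ∀ n, IsOpen (V n) ∧ Dense (V n) := fun n => by
    have : V n ∈ insert univ S := hV ▸ mem_range_self n
    rcases this with h | h
    · rw [h]; exact ⟨isOpen_univ, dense_univ⟩
    · exact ⟨hSo _ h, hSd _ h⟩
  have hW : ∀ k, IsOpen (⋂ n ∈ Finset.range k, V n) ∧ Dense (⋂ n ∈ Finset.range k, V n) := by
    intro k
    induction k with
    | zero => simp
    | succ k ih =>
      rw [Finset.range_add_one, Finset.set_biInter_insert]
      exact ⟨(hVod k).1.inter ih.1, (hVod k).2.inter_of_isOpen_left ih.2 (hVod k).1⟩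
  set W : ℕ → Set Z := fun k => ⋂ n ∈ Finset.range k, V n with hWdef
  have hWanti : Antitone W := fun i j hij =>
    biInter_subset_biInter_left fun n hn => Finset.range_mono hij hn
  have hWempty : ∀ z, ∃ k, z ∉ W k := by
    intro z
    by_contra! hz
    refine hS (mem_sInter.2 fun s hs => ?_ : z ∈ ⋂₀ S)
    obtain ⟨n, rfl⟩ : s ∈ range V := hV ▸ mem_insert_of_mem _ hs
    exact mem_iInter₂.1 (hz (n + 1)) n (by simp)
  obtain ⟨B, hBc, hB0, hB⟩ := TopologicalSpace.exists_countable_basis Z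
  obtain ⟨U, rfl⟩ := hBc.exists_eq_range (by
    obtain ⟨s, hs, -⟩ := hB.exists_subset_of_mem_open (mem_univ (Classical.arbitrary Z)) isOpen_univ
    exact ⟨s, hs⟩)
  have hex : ∀ k, (U k ∩ W k).Nonempty := fun k =>
    (hW k).2.inter_open_nonempty _ (hB.isOpen (mem_range_self k))
      (nonempty_iff_ne_empty.2 fun h => hB0 (h ▸ mem_range_self k))
  choose d hdU hdW using hex
  refine ⟨range d, countable_range d, ?_, ?_⟩
  · rw [hB.dense_iff]
    rintro _ ⟨k, rfl⟩ -
    exact ⟨d k, hdU k, mem_range_self k⟩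
  · have : range d = ⋂ k, (W k ∪ d '' Iio k) := by
      ext z
      simp only [mem_iInter]
      constructor
      · rintro ⟨j, rfl⟩ k
        rcases lt_or_ge j k with hjk | hjk
        · exact Or.inr (mem_image_of_mem d hjk)
        · exact Or.inl (hWanti hjk (hdW j))
      · intro hz
        obtain ⟨k, hk⟩ := hWempty z
        exact image_subset_range _ _ ((hz k).resolve_left hk)
    rw [this]
    exact .iInter fun k => (hW k).1.isGδ.union ((finite_Iio k).image d).isGδ

/-- An infinite power of a space with two points, if separable, has a countable dense subset
which is not `Gδ`. -/
theorem exists_countable_dense_not_isGδ {Y : Type*} [TopologicalSpace Y]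
    [TopologicalSpace.SeparableSpace (ℕ → Y)] [Nontrivial Y] :
    ∃ E : Set (ℕ → Y), E.Countable ∧ Dense E ∧ ¬ IsGδ E := by
  obtain ⟨a, b, hab⟩ := exists_pair_ne Y
  let φ : Cantor → ℕ → Y := fun c n => if c n then a else b
  have hφ : Continuous φ := continuous_pi fun n =>
    (continuous_of_discreteTopology (f := fun t : Bool => if t then a else b)).comp
      (continuous_apply n)
  have hinj : Function.Injective φ := by
    intro c c' h
    funext n
    have := congrFun h n
    cases hc : c n <;> cases hc' : c' n <;> simp_all [φ]
  obtain ⟨D, hDc, hDd⟩ := TopologicalSpace.exists_countable_dense (ℕ → Y)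
  obtain ⟨C, hCc, hCd⟩ := TopologicalSpace.exists_countable_dense Cantor
  refine ⟨D ∪ φ '' C, hDc.union (hCc.image φ), hDd.mono subset_union_left, fun hG => ?_⟩
  have hres := empty_mem_residual_of_countable_dense_isGδ Cantor.nhdsNE_neBot
    ((hDc.union (hCc.image φ)).preimage hinj)
    (hCd.mono fun c hc => Or.inr (mem_image_of_mem φ hc)) (hG.preimage hφ)
  exact (dense_of_mem_residual hres).nonempty.ne_empty rfl

theorem IsLambdaSet.exists_dense_isGδ {X : Set Cantor} (hX : IsLambdaSet X) :
    ∃ D : Set X, D.Countable ∧ Dense D ∧ IsGδ D := by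
  obtain ⟨D, hDc, hDd⟩ := TopologicalSpace.exists_countable_dense X
  obtain ⟨G, hG, hDG⟩ := hX (Subtype.val '' D) (Subtype.coe_image_subset X D) (hDc.image _)
  refine ⟨D, hDc, hDd, ?_⟩
  have : D = Subtype.val ⁻¹' G := by
    rw [← preimage_image_eq D Subtype.val_injective, hDG]
    ext x
    simp
  rw [this]
  exact hG.preimage continuous_subtype_val

/-- The countable power of an uncountable saturated λ-set is not CDH. -/
theorem countable_power_not_CDH_of_saturated_lambda (X : Set Cantor)
    (hunc : ¬ X.Countable) (hsat : Saturated X) (hlam : IsLambdaSet X) :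
    ¬ IsCDH (ℕ → ↥X) := by
  have hinf : X.Infinite := fun h => hunc h.countable
  have : Infinite X := hinf.to_subtype
  obtain ⟨D₀, hc₀, hd₀, hG₀⟩ := hlam.exists_dense_isGδ
  have hres : ∅ ∈ residual (ℕ → X) := by
    have h := empty_mem_residual_of_countable_dense_isGδ hsat.nhdsNE_neBot hc₀ hd₀ hG₀
    exact tendsto_residual_of_isOpenMap (f := fun z : ℕ → X => z 0) (continuous_apply 0)
      (isOpenMap_eval 0) h
  obtain ⟨D, hDc, hDd, hDG⟩ := exists_countable_dense_isGδ hres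
  obtain ⟨E, hEc, hEd, hEG⟩ := exists_countable_dense_not_isGδ (Y := X)
  intro hCDH
  obtain ⟨f, rfl⟩ := hCDH D E hDc hDd hEc hEd
  rw [f.image_eq_preimage_symm] at hEG
  exact hEG (hDG.preimage f.symm.continuous)
end
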